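/- Let G be a graph with no long theta, and let K be a tidy shortest long near-prism in G with constituent paths P1, P2, P3. Let x, y be K-major vertices such that y is distant from x. Then y has exactly two neighbours in A_{1,2,3}(x), and these two neighbours are adjacent. -/

import Mathlib

open SimpleGraph

namespace LEH

open scoped Classical

variable {V : Type*}

/-- `X` is anticomplete to `Y`: they are disjoint and there are no edges between them. -/
def Anticomplete (G : SimpleGraph V) (X Y : Set V) : Prop :=
  ∀ ⦃x⦄, x ∈ X → ∀ ⦃y⦄, y ∈ Y → x ≠ y ∧ ¬ G.Adj x y

/-- The vertex set of a walk. -/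
def vset {G : SimpleGraph V} {u v : V} (P : G.Walk u v) : Set V :=
  {x | x ∈ P.support}

/-- The interior of a path: its non-end vertices. -/
def inter {G : SimpleGraph V} {u v : V} (P : G.Walk u v) : Set V :=
  {x | x ∈ P.support ∧ x ≠ u ∧ x ≠ v}

/-- An induced path in `G`. -/
def IsInducedPath {G : SimpleGraph V} {u v : V} (P : G.Walk u v) : Prop :=
  P.IsPath ∧ ∀ x ∈ P.support, ∀ y ∈ P.support, G.Adj x y → s(x, y) ∈ P.edges

/-- A hole: an induced cycle of length at least 4. -/
def IsHole {G : SimpleGraph V} {u : V} (c : G.Walk u u) : Prop :=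
  c.IsCycle ∧ 4 ≤ c.length ∧
    ∀ x ∈ c.support, ∀ y ∈ c.support, G.Adj x y → s(x, y) ∈ c.edges

/-- A long even hole: a hole of even length at least `ℓ`. -/
def IsLongEvenHole (ℓ : ℕ) {G : SimpleGraph V} {u : V} (c : G.Walk u u) : Prop :=
  IsHole c ∧ ℓ ≤ c.length ∧ Even c.length

def HasLongEvenHole (G : SimpleGraph V) (ℓ : ℕ) : Prop :=
  ∃ (u : V) (c : G.Walk u u), IsLongEvenHole ℓ c

/-- A long theta in `G`: two nonadjacent vertices joined by three internally disjoint
induced paths with no edges between their interiors, any two of which form a long hole. -/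
def HasLongTheta (G : SimpleGraph V) (ℓ : ℕ) : Prop :=
  ∃ (u v : V) (P₁ P₂ P₃ : G.Walk u v),
    u ≠ v ∧ ¬ G.Adj u v ∧
    IsInducedPath P₁ ∧ IsInducedPath P₂ ∧ IsInducedPath P₃ ∧
    Anticomplete G (inter P₁) (inter P₂) ∧
    Anticomplete G (inter P₁) (inter P₃) ∧
    Anticomplete G (inter P₂) (inter P₃) ∧
    ℓ ≤ P₁.length + P₂.length ∧ ℓ ≤ P₁.length + P₃.length ∧
    ℓ ≤ P₂.length + P₃.length

/-- A long jewel of order `k` formed by `Q₁, Q₂, P`. -/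
def IsLongJewel (ℓ k : ℕ) {G : SimpleGraph V} {u v : V}
    (Q₁ Q₂ P : G.Walk u v) : Prop :=
  u ≠ v ∧
  IsInducedPath Q₁ ∧ IsInducedPath Q₂ ∧ IsInducedPath P ∧
  ¬ (Even Q₁.length ↔ Even Q₂.length) ∧
  max Q₁.support.length Q₂.support.length = k ∧
  ℓ ≤ P.length + min Q₁.length Q₂.length ∧
  Anticomplete G (inter P) (inter Q₁ ∪ inter Q₂)

def HasLongJewel (G : SimpleGraph V) (ℓ k : ℕ) : Prop :=
  ∃ (u v : V) (Q₁ Q₂ P : G.Walk u v), IsLongJewel ℓ k Q₁ Q₂ P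

/-- A long ban-the-bomb in `G`. -/
def IsLongBanTheBomb (ℓ : ℕ) {G : SimpleGraph V} (u v₁ w v₂ x : V)
    (P₁ : G.Walk x v₁) (P₂ : G.Walk x v₂) : Prop :=
  G.Adj u v₁ ∧ G.Adj v₁ w ∧ G.Adj w v₂ ∧ G.Adj v₂ u ∧ ¬ G.Adj v₁ v₂ ∧ u ≠ w ∧
  G.Adj x u ∧ ¬ G.Adj x v₁ ∧ ¬ G.Adj x v₂ ∧ ¬ G.Adj x w ∧
  x ≠ v₁ ∧ x ≠ v₂ ∧ x ≠ w ∧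
  IsInducedPath P₁ ∧ IsInducedPath P₂ ∧
  2 ≤ P₁.length ∧ 2 ≤ P₂.length ∧
  Anticomplete G (inter P₁) {u, w} ∧ Anticomplete G (inter P₂) {u, w} ∧
  Anticomplete G (vset P₁ \ {x}) (vset P₂ \ {x}) ∧
  ℓ ≤ P₁.length + 2 ∧ ℓ ≤ P₂.length + 2 ∧ ℓ ≤ P₁.length + P₂.length + 2

def HasLongBanTheBomb (G : SimpleGraph V) (ℓ : ℕ) : Prop :=
  ∃ (u v₁ w v₂ x : V) (P₁ : G.Walk x v₁) (P₂ : G.Walk x v₂),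
    IsLongBanTheBomb ℓ u v₁ w v₂ x P₁ P₂

/-- The induced subgraph of `G` on the vertex set `S` is a long hole. -/
def IsLongHoleOn (G : SimpleGraph V) (ℓ : ℕ) (S : Set V) : Prop :=
  ∃ (u : V) (c : G.Walk u u), IsHole c ∧ ℓ ≤ c.length ∧ {x | x ∈ c.support} = S

/-- A long near-prism with triangles `{a 0, a 1, a 2}`, `{b 0, b 1, b 2}` and
constituent paths `P 0, P 1, P 2`. -/
def IsLongNearPrism (ℓ : ℕ) {G : SimpleGraph V} (a b : Fin 3 → V)
    (P : ∀ i : Fin 3, G.Walk (a i) (b i)) : Prop :=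
  (∀ i j, i ≠ j → G.Adj (a i) (a j)) ∧
  (∀ i j, i ≠ j → G.Adj (b i) (b j)) ∧
  (Set.range a ∩ Set.range b).Subsingleton ∧
  (∀ i, (P i).IsPath) ∧
  (∀ i j, i ≠ j → ∀ x, x ∈ (P i).support → x ∉ (P j).support) ∧
  (∀ i j, i ≠ j → IsLongHoleOn G ℓ (vset (P i) ∪ vset (P j)))

def HasLongNearPrism (G : SimpleGraph V) (ℓ : ℕ) : Prop :=
  ∃ (a b : Fin 3 → V) (P : ∀ i : Fin 3, G.Walk (a i) (b i)), IsLongNearPrism ℓ a b P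

/-- A prospect: no long even hole of length at most `2ℓ`, no long jewel of order at most
`ℓ+1`, no long theta and no long ban-the-bomb. -/
def Prospect (G : SimpleGraph V) (ℓ : ℕ) : Prop :=
  (¬ ∃ (u : V) (c : G.Walk u u), IsLongEvenHole ℓ c ∧ c.length ≤ 2 * ℓ) ∧
  (¬ ∃ k ≤ ℓ + 1, HasLongJewel G ℓ k) ∧
  ¬ HasLongTheta G ℓ ∧ ¬ HasLongBanTheBomb G ℓ

/-- A candidate : a prospect with no long near-prism. -/
def Candidate (G : SimpleGraph V) (ℓ : ℕ) : Prop :=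
  Prospect G ℓ ∧ ¬ HasLongNearPrism G ℓ

/-- The vertex set of a near-prism. -/
def prismSupport {G : SimpleGraph V} {a b : Fin 3 → V}
    (P : ∀ i : Fin 3, G.Walk (a i) (b i)) : Set V :=
  ⋃ i, vset (P i)

/-- The near-prism, as a graph on `V`. -/
def prismGraph (G : SimpleGraph V) (a b : Fin 3 → V)
    (P : ∀ i : Fin 3, G.Walk (a i) (b i)) : SimpleGraph V :=
  SimpleGraph.fromEdgeSet
    ({e | ∃ i j, i ≠ j ∧ e = s(a i, a j)} ∪ {e | ∃ i j, i ≠ j ∧ e = s(b i, b j)} ∪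
      {e | ∃ i, e ∈ (P i).edges})

/-- `q` is `K`-major: `q` is outside the near-prism `K`, and no path of `K` with at most
three vertices contains all neighbours of `q` in `V(K)`. -/
def KMajor (G : SimpleGraph V) {a b : Fin 3 → V}
    (P : ∀ i : Fin 3, G.Walk (a i) (b i)) (q : V) : Prop :=
  q ∉ prismSupport P ∧
  ¬ ∃ (x y : V) (W : (prismGraph G a b P).Walk x y), W.IsPath ∧ W.length ≤ 2 ∧
      ∀ z ∈ prismSupport P, G.Adj q z → z ∈ W.support

/-- A shortest long near-prism. -/
def ShortestLNP (G : SimpleGraph V) (ℓ : ℕ) {a b : Fin 3 → V}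
    (P : ∀ i : Fin 3, G.Walk (a i) (b i)) : Prop :=
  IsLongNearPrism ℓ a b P ∧
  ∀ (a' b' : Fin 3 → V) (P' : ∀ i : Fin 3, G.Walk (a' i) (b' i)),
    IsLongNearPrism ℓ a' b' P' → (prismSupport P).ncard ≤ (prismSupport P').ncard

/-- The interior `F_K*` of the frame of a long near-prism: for each constituent path,
either the whole path (if it has length at most `ℓ-1`), or the non-end vertices of the
two stubs of length `ℓ/2 - 1` at its two ends. -/
def frameStar (ℓ : ℕ) {G : SimpleGraph V} {a b : Fin 3 → V}
    (P : ∀ i : Fin 3, G.Walk (a i) (b i)) : Set V :=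
  ⋃ i,
    if (P i).length ≤ ℓ - 1 then vset (P i)
    else {x | x ∈ (P i).support.take (ℓ / 2 - 1)} ∪
      {x | x ∈ (P i).support.reverse.take (ℓ / 2 - 1)}

/-- A long near-prism is tidy: it contains a frame (so at most one constituent path has
length at most `ℓ-1`) whose interior is anticomplete to the rest of the graph. -/
def Tidy (G : SimpleGraph V) (ℓ : ℕ) {a b : Fin 3 → V}
    (P : ∀ i : Fin 3, G.Walk (a i) (b i)) : Prop :=
  (∀ i j, (P i).length ≤ ℓ - 1 → (P j).length ≤ ℓ - 1 → i = j) ∧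
  Anticomplete G (frameStar ℓ P) {x | x ∉ prismSupport P}

/-- The index of the first neighbour of `x` in the list `l`. -/
noncomputable def firstNbrIdx (G : SimpleGraph V) (l : List V) (x : V) : ℕ :=
  l.findIdx (fun y => decide (G.Adj x y))

/-- `α(x)`: the neighbour of `x` on `P` nearest to the first end of `P`. -/
noncomputable def alpha (G : SimpleGraph V) {u w : V} (P : G.Walk u w) (x : V) : V :=
  P.support.getD (firstNbrIdx G P.support x) u

/-- `β(x)`: the neighbour of `x` on `P` nearest to the last end of `P`. -/
noncomputable def beta (G : SimpleGraph V) {u w : V} (P : G.Walk u w) (x : V) : V :=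
  P.support.reverse.getD (firstNbrIdx G P.support.reverse x) w

/-- `A(x)`: the vertex set of the subpath of `P` from its first end to `α(x)` if `x` has
a neighbour on `P`, and all of `V(P)` otherwise. -/
noncomputable def Aset (G : SimpleGraph V) {u w : V} (P : G.Walk u w) (x : V) : Set V :=
  if ∃ y ∈ P.support, G.Adj x y then
    {z | z ∈ P.support.take (firstNbrIdx G P.support x + 1)}
  else vset P

noncomputable def A123 (G : SimpleGraph V) {a b : Fin 3 → V}
    (P : ∀ i : Fin 3, G.Walk (a i) (b i)) (x : V) : Set V :=
  ⋃ i, Aset G (P i) x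

/-- The index of `v` in the list `l`. -/
noncomputable def listIdx (l : List V) (v : V) : ℕ :=
  l.findIdx (fun z => decide (z = v))

/-- `K^m_n(v)`: the union of the maximal subpath of `P` from `v` towards the first end of
`P` of length at most `m` with no internal vertex in `Fs`, and the maximal subpath of `P`
from `v` towards the last end of `P` of length at most `n` with no internal vertex in `Fs`. -/
noncomputable def Kmn (G : SimpleGraph V) (Fs : Set V) {u w : V}
    (P : G.Walk u w) (v : V) (m n : ℕ) : Set V :=
  let t := listIdx P.support v
  {z | ∃ r, r ≤ t ∧ t - r ≤ m ∧
      (∀ q, r < q → q < t → P.support.getD q v ∉ Fs) ∧ z = P.support.getD r v} ∪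
  {z | ∃ r, t ≤ r ∧ r < P.support.length ∧ r - t ≤ n ∧
      (∀ q, t < q → q < r → P.support.getD q v ∉ Fs) ∧ z = P.support.getD r v}

/-- `y` is distant from `x` (both `K`-major), for a tidy near-prism. -/
def Distant (G : SimpleGraph V) (ℓ : ℕ) {a b : Fin 3 → V}
    (P : ∀ i : Fin 3, G.Walk (a i) (b i)) (x y : V) : Prop :=
  ¬ G.Adj x y ∧
  (∃ z ∈ A123 G P x, G.Adj y z) ∧
  (∀ i, (∃ z ∈ (P i).support, G.Adj x z) →
    ∀ z ∈ Kmn G (frameStar ℓ P) (P i) (alpha G (P i) x) (ℓ - 2) 1, ¬ G.Adj y z) ∧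
  (∀ i, (¬ ∃ z ∈ (P i).support, G.Adj x z) →
    ∃ j, j ≠ i ∧
      ∀ z ∈ Kmn G (frameStar ℓ P) (P j) (beta G (P j) x) 0 (ℓ - 3), ¬ G.Adj y z)

/-- The hole `c`, regarded as a graph on `V`. -/
def holeGraph (G : SimpleGraph V) {u : V} (c : G.Walk u u) : SimpleGraph V :=
  SimpleGraph.fromEdgeSet {e | e ∈ c.edges}

/-- The distance between two vertices in the hole `c`. -/
noncomputable def holeDist (G : SimpleGraph V) {u : V} (c : G.Walk u u) (x y : V) : ℕ :=
  (holeGraph G c).dist x y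

/-- `x` is `C`-major for the hole `c`: `x` is not on `c` and no path of `c` with at most
three vertices contains all neighbours of `x` on `c`. -/
def CMajor (G : SimpleGraph V) {u : V} (c : G.Walk u u) (x : V) : Prop :=
  x ∉ c.support ∧
  ¬ ∃ q ∈ c.support, ∀ z ∈ c.support, G.Adj x z → z = q ∨ s(q, z) ∈ c.edges

/-- A shortest long even hole. -/
def ShortestLEH (G : SimpleGraph V) (ℓ : ℕ) {u : V} (c : G.Walk u u) : Prop :=
  IsLongEvenHole ℓ c ∧
  ∀ (v : V) (c' : G.Walk v v), IsLongEvenHole ℓ c' → c.length ≤ c'.length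

/-- `L₁, L₂` are the two `x y`-paths of the hole `c`. -/
def ArcPair {G : SimpleGraph V} {u : V} (c : G.Walk u u) {x y : V}
    (L₁ L₂ : G.Walk x y) : Prop :=
  L₁.IsPath ∧ L₂.IsPath ∧
  (∀ e ∈ L₁.edges, e ∈ c.edges) ∧ (∀ e ∈ L₂.edges, e ∈ c.edges) ∧
  (∀ e ∈ c.edges, e ∈ L₁.edges ∨ e ∈ L₂.edges) ∧
  (∀ e ∈ L₁.edges, e ∉ L₂.edges)

/-- `X` is lighter than `Y`, with respect to the linear order on edges given by `idx`. -/
def Lighter [DecidableEq V] (idx : Sym2 V → ℕ) (X Y : Finset (Sym2 V)) : Prop :=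
  X.card < Y.card ∨
  (X.card = Y.card ∧ ∃ e ∈ Y, e ∉ X ∧
    ∀ f : Sym2 V, ((f ∈ X ∧ f ∉ Y) ∨ (f ∈ Y ∧ f ∉ X)) → idx e ≤ idx f)

/-- The lightest long even hole. -/
def LightestLEH [DecidableEq V] (G : SimpleGraph V) (ℓ : ℕ) (idx : Sym2 V → ℕ)
    {u : V} (c : G.Walk u u) : Prop :=
  IsLongEvenHole ℓ c ∧
  ∀ (v : V) (c' : G.Walk v v), IsLongEvenHole ℓ c' →
    c'.edges.toFinset ≠ c.edges.toFinset →
    Lighter idx c.edges.toFinset c'.edges.toFinset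

/-- A `(C,x)`-gap: a path of the hole `c` of length at least two whose ends are adjacent
to `x` and none of whose interior vertices is adjacent to `x`. -/
def IsGap (G : SimpleGraph V) {u : V} (c : G.Walk u u) (x : V) {p₁ p₂ : V}
    (P : G.Walk p₁ p₂) : Prop :=
  P.IsPath ∧ (∀ e ∈ P.edges, e ∈ c.edges) ∧ 2 ≤ P.length ∧
  G.Adj x p₁ ∧ G.Adj x p₂ ∧ ∀ z ∈ inter P, ¬ G.Adj x z

end LEH

open LEH

namespace LEH

section InducedPaths

variable {V : Type*} {G : SimpleGraph V}

/-- There is an induced path of `G` from `u` to `v` with vertex set `S` and length `n`. -/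
def HasPath (G : SimpleGraph V) (S : Set V) (u v : V) (n : ℕ) : Prop :=
  ∃ W : G.Walk u v, IsInducedPath W ∧ W.length = n ∧ vset W = S

theorem HasPath.start_mem {S : Set V} {u v : V} {n : ℕ} (h : HasPath G S u v n) : u ∈ S := by
  obtain ⟨W, -, -, rfl⟩ := h
  exact W.start_mem_support

theorem HasPath.end_mem {S : Set V} {u v : V} {n : ℕ} (h : HasPath G S u v n) : v ∈ S := by
  obtain ⟨W, -, -, rfl⟩ := h
  exact W.end_mem_support

theorem HasPath.single (u : V) : HasPath G {u} u u 0 := by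
  refine ⟨.nil, ⟨by simp, ?_⟩, rfl, by ext; simp [vset]⟩
  intro x hx y hy h
  simp only [Walk.support_nil, List.mem_singleton] at hx hy
  subst hx hy
  exact (G.irrefl h).elim

theorem HasPath.symm {S : Set V} {u v : V} {n : ℕ} (h : HasPath G S u v n) :
    HasPath G S v u n := by
  obtain ⟨W, ⟨hp, hi⟩, rfl, rfl⟩ := h
  refine ⟨W.reverse, ⟨hp.reverse, ?_⟩, by simp, by ext; simp [vset]⟩
  intro x hx y hy h
  simp only [Walk.support_reverse, List.mem_reverse, Walk.edges_reverse] at *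
  exact hi x hx y hy h

theorem HasPath.join {S T : Set V} {u v u' v' : V} {n m : ℕ}
    (h₁ : HasPath G S u v n) (h₂ : HasPath G T u' v' m) (hadj : G.Adj v u')
    (hc : ∀ z ∈ S, ∀ z' ∈ T, z ≠ z' ∧ (G.Adj z z' → z = v ∧ z' = u')) :
    HasPath G (S ∪ T) u v' (n + m + 1) := by
  obtain ⟨W₁, ⟨hp₁, hi₁⟩, rfl, rfl⟩ := h₁
  obtain ⟨W₂, ⟨hp₂, hi₂⟩, rfl, rfl⟩ := h₂
  have hs : (W₁.append (.cons hadj W₂)).support = W₁.support ++ W₂.support := by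
    simp [Walk.support_append]
  refine ⟨W₁.append (.cons hadj W₂), ⟨?_, ?_⟩, by simp; omega, by ext; simp [vset, hs]⟩
  · rw [Walk.isPath_def, hs]
    refine List.Nodup.append hp₁.support_nodup hp₂.support_nodup ?_
    intro z hz hz'
    exact (hc z hz z hz').1 rfl
  · intro x hx y hy h
    rw [hs, List.mem_append] at hx hy
    rw [Walk.edges_append, Walk.edges_cons, List.mem_append, List.mem_cons]
    rcases hx with hx | hx <;> rcases hy with hy | hy
    · exact .inl (hi₁ x hx y hy h)
    · obtain ⟨rfl, rfl⟩ := (hc x hx y hy).2 h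
      exact .inr (.inl rfl)
    · obtain ⟨rfl, rfl⟩ := (hc y hy x hx).2 h.symm
      exact .inr (.inl Sym2.eq_swap)
    · exact .inr (.inr (hi₂ x hx y hy h))

/-- The set of values of `f` at the indices from `s` to `t`. -/
def Seg (f : ℕ → V) (s t : ℕ) : Set V :=
  {z | ∃ r, s ≤ r ∧ r ≤ t ∧ f r = z}

theorem HasPath.seg {f : ℕ → V} {s t : ℕ} (hst : s ≤ t)
    (hne : ∀ r r', s ≤ r → r < r' → r' ≤ t → f r ≠ f r')
    (hadj : ∀ r r', s ≤ r → r < r' → r' ≤ t → (G.Adj (f r) (f r') ↔ r + 1 = r')) :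
    HasPath G (Seg f s t) (f s) (f t) (t - s) := by
  induction t, hst using Nat.le_induction with
  | base =>
    have : Seg f s s = {f s} := by
      ext z
      constructor
      · rintro ⟨r, h1, h2, rfl⟩
        obtain rfl : r = s := by omega
        rfl
      · rintro rfl
        exact ⟨s, le_rfl, le_rfl, rfl⟩
    rw [this, Nat.sub_self]
    exact .single _
  | succ t hst ih =>
    have h := (ih (fun r r' h1 h2 h3 => hne r r' h1 h2 (by omega))
      (fun r r' h1 h2 h3 => hadj r r' h1 h2 (by omega))).join (.single (f (t + 1)))
      ((hadj t (t + 1) hst (by omega) le_rfl).2 rfl) (by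
        rintro _ ⟨r, h1, h2, rfl⟩ _ rfl
        refine ⟨hne r _ h1 (by omega) le_rfl, fun h => ⟨?_, rfl⟩⟩
        have := (hadj r (t + 1) h1 (by omega) le_rfl).1 h
        obtain rfl : r = t := by omega
        rfl)
    have h3 : Seg f s (t + 1) = Seg f s t ∪ {f (t + 1)} := by
      ext z
      constructor
      · rintro ⟨r, h1, h2, rfl⟩
        rcases Nat.lt_or_ge t r with h | h
        · obtain rfl : r = t + 1 := by omega
          exact .inr rfl
        · exact .inl ⟨r, h1, h, rfl⟩
      · rintro (⟨r, h1, h2, rfl⟩ | rfl)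
        · exact ⟨r, h1, by omega, rfl⟩
        · exact ⟨t + 1, by omega, le_rfl, rfl⟩
    rw [h3]
    convert h using 1
    omega

theorem HasPath.length_eq_zero {S : Set V} {u : V} {n : ℕ} (h : HasPath G S u u n) : n = 0 := by
  obtain ⟨W, ⟨hp, -⟩, rfl, -⟩ := h
  exact Walk.length_eq_zero_iff.2 (Walk.isPath_iff_nil.1 hp)

theorem HasPath.ncard_le {S : Set V} {u v : V} {n : ℕ} (h : HasPath G S u v n) :
    S.ncard ≤ n + 1 := by
  classical
  obtain ⟨W, -, rfl, rfl⟩ := h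
  have : vset W = (W.support.toFinset : Set V) := by ext; simp [vset]
  rw [this, Set.ncard_coe_finset, ← Walk.length_support]
  exact W.support.toFinset_card_le

theorem isLongHoleOn_union {ℓ : ℕ} {S T : Set V} {a b a' b' : V} {n m : ℕ}
    (h₁ : HasPath G S a b n) (h₂ : HasPath G T a' b' m)
    (ha : G.Adj a a') (hb : G.Adj b b')
    (hc : ∀ z ∈ S, ∀ z' ∈ T, z ≠ z' ∧ (G.Adj z z' → z = a ∧ z' = a' ∨ z = b ∧ z' = b'))
    (h4 : 4 ≤ n + m + 2) (hl : ℓ ≤ n + m + 2) : IsLongHoleOn G ℓ (S ∪ T) := by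
  have h₁' := h₁
  have h₂' := h₂
  obtain ⟨W₁, ⟨hp₁, hi₁⟩, hn, rfl⟩ := h₁
  obtain ⟨W₂, ⟨hp₂, hi₂⟩, hm, rfl⟩ := h₂
  set U : G.Walk a a' := W₁.append (.cons hb W₂.reverse) with hU
  have hs : U.support = W₁.support ++ W₂.support.reverse := by
    simp [hU, Walk.support_append]
  have he : U.edges = W₁.edges ++ s(b, b') :: W₂.edges.reverse := by
    simp [hU]
  have hlen : U.length = n + m + 1 := by
    simp [hU, hn, hm]; omega
  have hUp : U.IsPath := by
    rw [Walk.isPath_def, hs]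
    refine List.Nodup.append hp₁.support_nodup (List.nodup_reverse.2 hp₂.support_nodup) ?_
    intro z hz hz'
    exact (hc z hz z (List.mem_reverse.1 hz')).1 rfl
  refine ⟨a', .cons ha.symm U, ⟨?_, ?_, ?_⟩, ?_, ?_⟩
  · rw [Walk.cons_isCycle_iff]
    refine ⟨hUp, ?_⟩
    rw [he, List.mem_append, List.mem_cons, List.mem_reverse]
    rintro (h | h | h)
    · exact (hc a' (W₁.fst_mem_support_of_mem_edges h) a' W₂.start_mem_support).1 rfl
    · rcases Sym2.eq_iff.1 h with ⟨rfl, rfl⟩ | ⟨rfl, rfl⟩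
      · exact (hc a' W₁.end_mem_support a' W₂.start_mem_support).1 rfl
      · have := h₁'.length_eq_zero
        have := h₂'.length_eq_zero
        omega
    · exact (hc a W₁.start_mem_support a (W₂.snd_mem_support_of_mem_edges h)).1 rfl
  · simp only [Walk.length_cons]
    omega
  · have key : ∀ x ∈ W₁.support ++ W₂.support, ∀ y ∈ W₁.support ++ W₂.support, G.Adj x y →
        s(x, y) ∈ s(a', a) :: U.edges := by
      intro x hx y hy h
      rw [List.mem_append] at hx hy
      simp only [he, List.mem_cons, List.mem_append, List.mem_reverse]
      rcases hx with hx | hx <;> rcases hy with hy | hy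
      · exact .inr (.inl (hi₁ x hx y hy h))
      · rcases (hc x hx y hy).2 h with ⟨rfl, rfl⟩ | ⟨rfl, rfl⟩
        · exact .inl Sym2.eq_swap
        · exact .inr (.inr (.inl rfl))
      · rcases (hc y hy x hx).2 h.symm with ⟨rfl, rfl⟩ | ⟨rfl, rfl⟩
        · exact .inl rfl
        · exact .inr (.inr (.inl Sym2.eq_swap))
      · exact .inr (.inr (.inr (hi₂ x hx y hy h)))
    have hmem : ∀ z, z ∈ (Walk.cons ha.symm U).support → z ∈ W₁.support ++ W₂.support := by
      intro z hz
      rw [Walk.support_cons, List.mem_cons, hs] at hz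
      rcases hz with rfl | hz
      · simp
      · simpa using hz
    intro x hx y hy h
    rw [Walk.edges_cons]
    exact key x (hmem x hx) y (hmem y hy) h
  · simp only [Walk.length_cons]
    omega
  · ext z
    simp only [Walk.support_cons, List.mem_cons, hs, List.mem_append, List.mem_reverse,
      Set.mem_ofPred_eq, vset, Set.mem_union]
    constructor
    · rintro (rfl | h)
      · exact .inr W₂.start_mem_support
      · exact h
    · exact .inr

/-- `S` is the interior of an induced path with `n + 2` edges between `u` and `v`. -/
def Leg (G : SimpleGraph V) (u v : V) (S : Set V) (n : ℕ) : Prop :=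
  ∃ s t, HasPath G S s t n ∧ G.Adj u s ∧ G.Adj v t ∧
    ∀ z ∈ S, u ≠ z ∧ v ≠ z ∧ (G.Adj u z → z = s) ∧ (G.Adj v z → z = t)

theorem Leg.exists_walk {u v : V} {S : Set V} {n : ℕ} (h : Leg G u v S n) (huv : u ≠ v)
    (hna : ¬ G.Adj u v) :
    ∃ W : G.Walk u v, IsInducedPath W ∧ W.length = n + 2 ∧ inter W = S := by
  obtain ⟨s, t, hp, hus, hvt, hS⟩ := h
  have h1 : HasPath G (S ∪ {v}) s v (n + 0 + 1) := hp.join (.single v) hvt.symm (by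
    rintro z hz _ rfl
    exact ⟨(hS z hz).2.1.symm, fun h => ⟨(hS z hz).2.2.2 h.symm, rfl⟩⟩)
  have h2 : HasPath G ({u} ∪ (S ∪ {v})) u v (0 + (n + 0 + 1) + 1) :=
    (HasPath.single u).join h1 hus (by
    rintro _ rfl z (hz | rfl)
    · exact ⟨(hS z hz).1, fun h => ⟨rfl, (hS z hz).2.2.1 h⟩⟩
    · exact ⟨huv, fun h => (hna h).elim⟩)
  obtain ⟨W, hW, hl, hs⟩ := h2
  refine ⟨W, hW, by omega, ?_⟩
  ext z
  have hz : z ∈ W.support ↔ z ∈ ({u} ∪ (S ∪ {v}) : Set V) := by rw [← hs]; rfl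
  simp only [inter, Set.mem_ofPred_eq, hz, Set.mem_union, Set.mem_singleton_iff]
  constructor
  · tauto
  · intro h
    exact ⟨.inr (.inl h), (hS z h).1.symm, (hS z h).2.1.symm⟩

theorem hasLongTheta_of_legs {ℓ : ℕ} {u v : V} {S₁ S₂ S₃ : Set V} {n₁ n₂ n₃ : ℕ}
    (huv : u ≠ v) (hna : ¬ G.Adj u v)
    (h₁ : Leg G u v S₁ n₁) (h₂ : Leg G u v S₂ n₂) (h₃ : Leg G u v S₃ n₃)
    (h₁₂ : Anticomplete G S₁ S₂) (h₁₃ : Anticomplete G S₁ S₃) (h₂₃ : Anticomplete G S₂ S₃)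
    (l₁₂ : ℓ ≤ n₁ + n₂ + 4) (l₁₃ : ℓ ≤ n₁ + n₃ + 4) (l₂₃ : ℓ ≤ n₂ + n₃ + 4) :
    HasLongTheta G ℓ := by
  obtain ⟨W₁, i₁, hl₁, rfl⟩ := h₁.exists_walk huv hna
  obtain ⟨W₂, i₂, hl₂, rfl⟩ := h₂.exists_walk huv hna
  obtain ⟨W₃, i₃, hl₃, rfl⟩ := h₃.exists_walk huv hna
  exact ⟨u, v, W₁, W₂, W₃, huv, hna, i₁, i₂, i₃, h₁₂, h₁₃, h₂₃, by omega, by omega, by omega⟩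

/-- `S` and `T` are disjoint and the only edges between them are those from `a` to `a'` and
from `b` to `b'`, both of which are present. -/
def Rungs (G : SimpleGraph V) (S T : Set V) (a b a' b' : V) : Prop :=
  G.Adj a a' ∧ G.Adj b b' ∧
    ∀ z ∈ S, ∀ z' ∈ T, z ≠ z' ∧ (G.Adj z z' → z = a ∧ z' = a' ∨ z = b ∧ z' = b')

theorem Rungs.symm {S T : Set V} {a b a' b' : V} (h : Rungs G S T a b a' b') :
    Rungs G T S a' b' a b := by
  refine ⟨h.1.symm, h.2.1.symm, fun z hz z' hz' => ⟨(h.2.2 z' hz' z hz).1.symm, fun hh => ?_⟩⟩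
  rcases (h.2.2 z' hz' z hz).2 hh.symm with h | h
  · exact .inl h.symm
  · exact .inr h.symm

/-- There is a long near-prism in `G` with at most `N` vertices. -/
def HasPrism (G : SimpleGraph V) (ℓ N : ℕ) : Prop :=
  ∃ (a b : Fin 3 → V) (P : ∀ i : Fin 3, G.Walk (a i) (b i)),
    IsLongNearPrism ℓ a b P ∧ (prismSupport P).ncard ≤ N

theorem hasPrism_of_rungs {ℓ : ℕ} (hℓ : 4 ≤ ℓ) {S₁ S₂ S₃ : Set V}
    {a₁ a₂ a₃ b₁ b₂ b₃ : V} {n₁ n₂ n₃ : ℕ}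
    (h₁ : HasPath G S₁ a₁ b₁ n₁) (h₂ : HasPath G S₂ a₂ b₂ n₂) (h₃ : HasPath G S₃ a₃ b₃ n₃)
    (r₁₂ : Rungs G S₁ S₂ a₁ b₁ a₂ b₂) (r₁₃ : Rungs G S₁ S₃ a₁ b₁ a₃ b₃)
    (r₂₃ : Rungs G S₂ S₃ a₂ b₂ a₃ b₃)
    (l₁₂ : ℓ ≤ n₁ + n₂ + 2) (l₁₃ : ℓ ≤ n₁ + n₃ + 2) (l₂₃ : ℓ ≤ n₂ + n₃ + 2) :
    HasPrism G ℓ (n₁ + n₂ + n₃ + 3) := by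
  let a : Fin 3 → V := ![a₁, a₂, a₃]
  let b : Fin 3 → V := ![b₁, b₂, b₃]
  let S : Fin 3 → Set V := ![S₁, S₂, S₃]
  let n : Fin 3 → ℕ := ![n₁, n₂, n₃]
  have hp : ∀ i, HasPath G (S i) (a i) (b i) (n i) := by
    intro i
    fin_cases i
    · exact h₁
    · exact h₂
    · exact h₃
  have hr : ∀ i j, i ≠ j → Rungs G (S i) (S j) (a i) (b i) (a j) (b j) := by
    intro i j hij
    fin_cases i <;> fin_cases j
    · exact (hij rfl).elim
    · exact r₁₂
    · exact r₁₃
    · exact r₁₂.symm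
    · exact (hij rfl).elim
    · exact r₂₃
    · exact r₁₃.symm
    · exact r₂₃.symm
    · exact (hij rfl).elim
  have hl : ∀ i j, i ≠ j → ℓ ≤ n i + n j + 2 := by
    intro i j hij
    fin_cases i <;> fin_cases j <;> simp [n] at hij ⊢ <;> omega
  have hp' := hp
  choose P hP hn hS using hp
  refine ⟨a, b, P, ⟨fun i j hij => (hr i j hij).1, fun i j hij => (hr i j hij).2.1, ?_,
    fun i => (hP i).1, ?_, ?_⟩, ?_⟩
  · have hab : ∀ i j, a i = b j → i = j ∧ n i = 0 := by
      intro i j h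
      obtain rfl : i = j := by
        by_contra hij
        exact ((hr i j hij).2.2 _ (hp' i).start_mem _ (hp' j).end_mem).1 h
      refine ⟨rfl, ?_⟩
      have := hp' i
      rw [← h] at this
      exact this.length_eq_zero
    rintro _ ⟨⟨i, rfl⟩, ⟨j, hj⟩⟩ _ ⟨⟨i', rfl⟩, ⟨j', hj'⟩⟩
    have e1 := hab i j hj.symm
    have e2 := hab i' j' hj'.symm
    by_cases h : i = i'
    · rw [h]
    · have := hl i i' h
      omega
  · intro i j hij z hz hz'
    have hz1 : z ∈ S i := by rw [← hS i]; exact hz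
    have hz2 : z ∈ S j := by rw [← hS j]; exact hz'
    exact ((hr i j hij).2.2 z hz1 z hz2).1 rfl
  · intro i j hij
    rw [hS i, hS j]
    have := hl i j hij
    exact isLongHoleOn_union (hp' i) (hp' j) (hr i j hij).1 (hr i j hij).2.1 (hr i j hij).2.2
      (by omega) this
  · have : prismSupport P = S₁ ∪ S₂ ∪ S₃ := by
      ext z
      simp only [prismSupport, Set.mem_iUnion, hS]
      simp [Fin.exists_fin_succ, S, or_assoc]
    rw [this]
    have c1 := Set.ncard_union_le (S₁ ∪ S₂) S₃
    have c2 := Set.ncard_union_le S₁ S₂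
    have := h₁.ncard_le
    have := h₂.ncard_le
    have := h₃.ncard_le
    omega

end InducedPaths

end LEH

namespace LEH

section Pyramids

variable {V : Type*} {G : SimpleGraph V}

/-- Three paths `q i 0, …, q i (c i) = w` with common end `w` that form a pyramid with apex `w`
and base `{q 0 0, q 1 0, q 2 0}`. -/
structure Pyramid (G : SimpleGraph V) (q : Fin 3 → ℕ → V) (c : Fin 3 → ℕ) (w : V) : Prop where
  apex : ∀ i, q i (c i) = w
  ne : ∀ i s t, s < t → t ≤ c i → q i s ≠ q i t
  adj : ∀ i s t, s < t → t ≤ c i → (G.Adj (q i s) (q i t) ↔ s + 1 = t)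
  cross : ∀ i j s t, i ≠ j → s < c i → t < c j →
    q i s ≠ q j t ∧ (G.Adj (q i s) (q j t) ↔ s = 0 ∧ t = 0)

namespace Pyramid

variable {q : Fin 3 → ℕ → V} {c : Fin 3 → ℕ} {w : V}

theorem eq_iff (H : Pyramid G q c w) {i j : Fin 3} (hij : i ≠ j) {s t : ℕ} (hs : s ≤ c i)
    (ht : t ≤ c j) : q i s = q j t ↔ s = c i ∧ t = c j := by
  rcases hs.eq_or_lt with rfl | hs'
  · rw [H.apex, ← H.apex j]
    rcases ht.eq_or_lt with rfl | ht'
    · simp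
    · have := H.ne j t _ ht' le_rfl
      simp only [this.symm, false_iff]
      omega
  · rcases ht.eq_or_lt with rfl | ht'
    · rw [H.apex, ← H.apex i]
      have := H.ne i s _ hs' le_rfl
      simp only [this, false_iff]
      omega
    · have := (H.cross i j s t hij hs' ht').1
      simp only [this, false_iff]
      omega

theorem adj_same (H : Pyramid G q c w) {i : Fin 3} {s t : ℕ} (hs : s ≤ c i) (ht : t ≤ c i) :
    G.Adj (q i s) (q i t) ↔ s + 1 = t ∨ t + 1 = s := by
  rcases lt_trichotomy s t with h | rfl | h
  · rw [H.adj i s t h ht]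
    omega
  · simp
  · rw [G.adj_comm, H.adj i t s h hs]
    omega

theorem eq_same (H : Pyramid G q c w) {i : Fin 3} {s t : ℕ} (hs : s ≤ c i) (ht : t ≤ c i) :
    q i s = q i t ↔ s = t := by
  rcases lt_trichotomy s t with h | rfl | h
  · exact iff_of_false (H.ne i s t h ht) (by omega)
  · simp
  · exact iff_of_false (H.ne i t s h hs).symm (by omega)

theorem adj_iff (H : Pyramid G q c w) {i j : Fin 3} (hij : i ≠ j) {s t : ℕ} (hs : s ≤ c i)
    (ht : t ≤ c j) (hi : 1 ≤ c i) (hj : 1 ≤ c j) : G.Adj (q i s) (q j t) ↔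
      s = 0 ∧ t = 0 ∨ s = c i ∧ t + 1 = c j ∨ t = c j ∧ s + 1 = c i := by
  rcases hs.eq_or_lt with rfl | hs'
  · rw [H.apex, ← H.apex j, H.adj_same le_rfl ht]
    omega
  · rcases ht.eq_or_lt with rfl | ht'
    · rw [H.apex, ← H.apex i, H.adj_same hs le_rfl]
      omega
    · rw [(H.cross i j s t hij hs' ht').2]
      omega

theorem seg (H : Pyramid G q c w) (i : Fin 3) {s t : ℕ} (hst : s ≤ t) (ht : t ≤ c i) :
    HasPath G (Seg (q i) s t) (q i s) (q i t) (t - s) :=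
  .seg hst (fun r r' _ h2 h3 => H.ne i r r' h2 (by omega))
    (fun r r' _ h2 h3 => H.adj i r r' h2 (by omega))

theorem theta_of_legs (H : Pyramid G q c w) {ℓ m : ℕ} (hℓ : ℓ = 2 * m + 2) (hm : 2 ≤ m)
    {i k : Fin 3} (hik : i ≠ k) {u : V} {d g t n : ℕ} {S : Set V} {r₁ r₂ : V}
    (hmd : m ≤ d + 1) (hdg : d + 2 ≤ g) (hg : g + 2 * m ≤ c i + 1) (hmt : m ≤ t) (ht : t ≤ c k)
    (hui : ∀ s, s ≤ d ∨ g ≤ s → s ≤ c i → u ≠ q i s ∧ (G.Adj u (q i s) ↔ s = d ∨ s = g))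
    (huk : ∀ s, s ≤ c k → u ≠ q k s ∧ ¬ G.Adj u (q k s))
    (hS : HasPath G S r₁ r₂ n) (hur : G.Adj u r₁) (hr : G.Adj r₂ (q k t))
    (hSu : ∀ r ∈ S, u ≠ r ∧ (G.Adj u r → r = r₁))
    (hSi : ∀ r ∈ S, ∀ s, s ≤ d ∨ g ≤ s → s < c i → r ≠ q i s ∧ ¬ G.Adj r (q i s))
    (hSk : ∀ r ∈ S, ∀ s ≤ c k, r ≠ q k s ∧ (G.Adj r (q k s) → r = r₂ ∧ s = t)) :
    HasLongTheta G ℓ := by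
  have l2 : Leg G u (q k t) (Seg (q i) 0 d ∪ Seg (q k) 0 (t - 1)) (d - 0 + (t - 1 - 0) + 1) := by
    refine ⟨q i d, q k (t - 1), ?_, ?_, ?_, ?_⟩
    · refine (H.seg i (Nat.zero_le _) (by omega)).symm.join
        (H.seg k (Nat.zero_le _) (by omega)) ?_ ?_
      · rw [H.adj_iff hik] <;> omega
      · rintro _ ⟨r, h1, h2, rfl⟩ _ ⟨r', h1', h2', rfl⟩
        rw [ne_eq, H.eq_iff hik (by omega) (by omega), H.adj_iff hik (by omega) (by omega)
          (by omega) (by omega), H.eq_same (by omega) (by omega), H.eq_same (by omega) (by omega)]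
        omega
    · rw [(hui d (by omega) (by omega)).2]
      omega
    · rw [H.adj_same] <;> omega
    · rintro _ (⟨r, h1, h2, rfl⟩ | ⟨r, h1, h2, rfl⟩)
      · refine ⟨(hui r (by omega) (by omega)).1, ?_⟩
        rw [(hui r (by omega) (by omega)).2, G.adj_comm, H.adj_iff hik (by omega) (by omega)
          (by omega) (by omega), ne_comm, ne_eq, H.eq_iff hik (by omega) (by omega),
          H.eq_same (by omega) (by omega)]
        omega
      · refine ⟨(huk r (by omega)).1, ?_⟩
        rw [ne_eq, H.eq_same (by omega) (by omega), H.eq_same (by omega) (by omega),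
          H.adj_same (by omega) (by omega)]
        exact ⟨by omega, fun h => ((huk r (by omega)).2 h).elim, by omega⟩
  have l3 : Leg G u (q k t) S n := by
    refine ⟨r₁, r₂, hS, hur, hr.symm, fun r h => ⟨(hSu r h).1, ((hSk r h t ht).1).symm,
      (hSu r h).2, fun hh => ((hSk r h t ht).2 hh.symm).1⟩⟩
  have a23 : Anticomplete G (Seg (q i) 0 d ∪ Seg (q k) 0 (t - 1)) S := by
    rintro _ (⟨s, h1, h2, rfl⟩ | ⟨s, h1, h2, rfl⟩) r hr
    · have := hSi r hr s (by omega) (by omega)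
      exact ⟨this.1.symm, fun h => this.2 h.symm⟩
    · have := hSk r hr s (by omega)
      exact ⟨this.1.symm, fun h => by have := this.2 h.symm; omega⟩
  have a12 : Anticomplete G (Seg (q i) g (c i - 1)) (Seg (q i) 0 d ∪ Seg (q k) 0 (t - 1)) := by
    rintro _ ⟨r, h1, h2, rfl⟩ _ (⟨r', h1', h2', rfl⟩ | ⟨r', h1', h2', rfl⟩)
    · rw [ne_eq, H.eq_same (by omega) (by omega), H.adj_same (by omega) (by omega)]
      omega
    · rw [ne_eq, H.eq_iff hik (by omega) (by omega), H.adj_iff hik (by omega) (by omega)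
        (by omega) (by omega)]
      omega
  have a13 : Anticomplete G (Seg (q i) g (c i - 1)) S := by
    rintro _ ⟨s, h1, h2, rfl⟩ r hr
    have := hSi r hr s (by omega) (by omega)
    exact ⟨this.1.symm, fun h => this.2 h.symm⟩
  have p1 : HasPath G (Seg (q i) g (c i - 1)) (q i g) (q i (c i - 1)) (c i - 1 - g) :=
    H.seg i (by omega) (by omega)
  have ug : G.Adj u (q i g) := by
    rw [(hui g (by omega) (by omega)).2]
    omega
  have hut := huk t ht
  rcases ht.eq_or_lt with rfl | ht'
  · have l1 : Leg G u (q k (c k)) (Seg (q i) g (c i - 1)) (c i - 1 - g) := by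
      refine ⟨_, _, p1, ug, ?_, ?_⟩
      · rw [H.apex, ← H.apex i, H.adj_same] <;> omega
      · rintro _ ⟨r, h1, h2, rfl⟩
        refine ⟨(hui r (by omega) (by omega)).1, ?_⟩
        rw [(hui r (by omega) (by omega)).2, H.apex, ← H.apex i, H.adj_same (by omega) (by omega),
          ne_eq, H.eq_same (by omega) (by omega), H.eq_same (by omega) (by omega),
          H.eq_same (by omega) (by omega)]
        omega
    exact hasLongTheta_of_legs hut.1 hut.2 l1 l2 l3 a12 a13 a23 (by omega) (by omega) (by omega)
  · have l1 : Leg G u (q k t) (Seg (q i) g (c i - 1) ∪ Seg (q k) (t + 1) (c k))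
        (c i - 1 - g + (c k - (t + 1)) + 1) := by
      refine ⟨q i g, q k (t + 1), p1.join (H.seg k ht' le_rfl).symm ?_ ?_, ug, ?_, ?_⟩
      · rw [H.adj_iff hik] <;> omega
      · rintro _ ⟨r, h1, h2, rfl⟩ _ ⟨r', h1', h2', rfl⟩
        rw [ne_eq, H.eq_iff hik (by omega) (by omega), H.adj_iff hik (by omega) (by omega)
          (by omega) (by omega), H.eq_same (by omega) (by omega), H.eq_same (by omega) (by omega)]
        omega
      · rw [H.adj_same] <;> omega
      · rintro _ (⟨r, h1, h2, rfl⟩ | ⟨r, h1, h2, rfl⟩)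
        · refine ⟨(hui r (by omega) (by omega)).1, ?_⟩
          rw [(hui r (by omega) (by omega)).2, G.adj_comm, H.adj_iff hik (by omega) (by omega)
            (by omega) (by omega), ne_comm, ne_eq, H.eq_iff hik (by omega) (by omega),
            H.eq_same (by omega) (by omega)]
          omega
        · refine ⟨(huk r (by omega)).1, ?_⟩
          rw [ne_eq, H.eq_same (by omega) (by omega), H.eq_same (by omega) (by omega),
            H.adj_same (by omega) (by omega)]
          exact ⟨by omega, fun h => ((huk r (by omega)).2 h).elim, by omega⟩
    refine hasLongTheta_of_legs hut.1 hut.2 l1 l2 l3 ?_ ?_ a23 (by omega) (by omega) (by omega)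
    · rintro z (hz | ⟨r, h1, h2, rfl⟩) z' hz'
      · exact a12 hz hz'
      · obtain ⟨r', h1', h2', rfl⟩ | ⟨r', h1', h2', rfl⟩ := hz'
        · rw [ne_comm, ne_eq, H.eq_iff hik (by omega) (by omega), G.adj_comm,
            H.adj_iff hik (by omega) (by omega) (by omega) (by omega)]
          omega
        · rw [ne_eq, H.eq_same (by omega) (by omega), H.adj_same (by omega) (by omega)]
          omega
    · rintro z (hz | ⟨s, h1, h2, rfl⟩) r hr
      · exact a13 hz hr
      · have := hSk r hr s (by omega)
        exact ⟨this.1.symm, fun h => by have := this.2 h.symm; omega⟩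

theorem theta_of_attachment (H : Pyramid G q c w) {ℓ m : ℕ} (hℓ : ℓ = 2 * m + 2) (hm : 2 ≤ m)
    {i k : Fin 3} (hik : i ≠ k) {y : V} {d g t n : ℕ} {S : Set V} {r₁ r₂ : V}
    (hmd : m ≤ d) (hdg : d ≤ g) (hdg' : g ≠ d + 1) (hg : g + 2 * m ≤ c i) (hmt : m ≤ t)
    (ht : t ≤ c k) (hyd : G.Adj y (q i d)) (hyg : G.Adj y (q i g))
    (hyi : ∀ s ≤ c i, y ≠ q i s ∧ (G.Adj y (q i s) → d ≤ s ∧ s ≤ g))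
    (hyk : ∀ s ≤ c k, y ≠ q k s ∧ ¬ G.Adj y (q k s))
    (hS : HasPath G S r₁ r₂ n) (hyr : G.Adj y r₁) (hr : G.Adj r₂ (q k t))
    (hSy : ∀ r ∈ S, y ≠ r ∧ (G.Adj y r → r = r₁))
    (hSi : ∀ r ∈ S, ∀ s < c i, r ≠ q i s ∧ ¬ G.Adj r (q i s))
    (hSk : ∀ r ∈ S, ∀ s ≤ c k, r ≠ q k s ∧ (G.Adj r (q k s) → r = r₂ ∧ s = t)) :
    HasLongTheta G ℓ := by
  rcases hdg.eq_or_lt with rfl | hlt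
  · have hS' : HasPath G ({y} ∪ S) y r₂ (0 + n + 1) := (HasPath.single y).join hS hyr (by
      rintro _ rfl r hr
      exact ⟨(hSy r hr).1, fun h => ⟨rfl, (hSy r hr).2 h⟩⟩)
    refine H.theta_of_legs hℓ hm hik (u := q i d) (d := d - 1) (g := d + 1) (t := t)
      (by omega) (by omega) (by omega) hmt ht ?_ ?_ hS' hyd.symm hr ?_ ?_ ?_
    · intro s hs hs'
      rw [ne_eq, H.eq_same (by omega) (by omega), H.adj_same (by omega) (by omega)]
      omega
    · intro s hs
      rw [ne_eq, H.eq_iff hik (by omega) (by omega), H.adj_iff hik (by omega) (by omega)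
        (by omega) (by omega)]
      omega
    · rintro r (rfl | hr)
      · exact ⟨((hyi d (by omega)).1).symm, fun _ => rfl⟩
      · have := hSi r hr d (by omega)
        exact ⟨this.1.symm, fun h => (this.2 h.symm).elim⟩
    · rintro r (rfl | hr) s hs hs'
      · refine ⟨(hyi s (by omega)).1, fun h => ?_⟩
        have := (hyi s (by omega)).2 h
        omega
      · exact hSi r hr s hs'
    · rintro r (rfl | hr) s hs
      · exact ⟨(hyk s hs).1, fun h => ((hyk s hs).2 h).elim⟩
      · exact hSk r hr s hs
  · refine H.theta_of_legs hℓ hm hik (u := y) (d := d) (g := g) (t := t)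
      (by omega) (by omega) (by omega) hmt ht ?_ hyk hS hyr hr hSy
      (fun r hr s _ => hSi r hr s) hSk
    intro s hs hs'
    refine ⟨(hyi s hs').1, fun h => ?_, ?_⟩
    · have := (hyi s hs').2 h
      omega
    · rintro (rfl | rfl)
      · exact hyd
      · exact hyg

theorem theta_apex (H : Pyramid G q c w) {ℓ m : ℕ} (hℓ : ℓ = 2 * m + 2) (hm : 2 ≤ m)
    {y : V} {g : Fin 3 → ℕ} (hg : ∀ i, g i + 2 * m ≤ c i) (hg' : ∀ i, 1 ≤ g i)
    (hyg : ∀ i, G.Adj y (q i (g i)))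
    (hyi : ∀ i, ∀ s ≤ c i, y ≠ q i s ∧ (G.Adj y (q i s) → s ≤ g i)) :
    HasLongTheta G ℓ := by
  have leg : ∀ i, Leg G y w (Seg (q i) (g i) (c i - 1)) (c i - 1 - g i) := by
    intro i
    have := hg i
    refine ⟨_, _, H.seg i (by omega) (by omega), hyg i, ?_, ?_⟩
    · rw [← H.apex i, H.adj_same] <;> omega
    · rintro _ ⟨r, h1, h2, rfl⟩
      refine ⟨(hyi i r (by omega)).1, ?_⟩
      rw [← H.apex i, H.adj_same (by omega) (by omega),
        ne_eq, H.eq_same (by omega) (by omega), H.eq_same (by omega) (by omega),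
        H.eq_same (by omega) (by omega)]
      refine ⟨by omega, fun h => ?_, by omega⟩
      have := (hyi i r (by omega)).2 h
      omega
  have anti : ∀ i j, i ≠ j →
      Anticomplete G (Seg (q i) (g i) (c i - 1)) (Seg (q j) (g j) (c j - 1)) := by
    rintro i j hij _ ⟨r, h1, h2, rfl⟩ _ ⟨r', h1', h2', rfl⟩
    have := hg i
    have := hg j
    have := hg' i
    rw [ne_eq, H.eq_iff hij (by omega) (by omega), H.adj_iff hij (by omega) (by omega)
      (by omega) (by omega)]
    omega
  have h0 := hyi 0 _ le_rfl
  rw [H.apex] at h0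
  have g0 := hg 0
  have g1 := hg 1
  have g2 := hg 2
  exact hasLongTheta_of_legs h0.1 (fun h => by have := h0.2 h; omega) (leg 0) (leg 1) (leg 2)
    (anti 0 1 (by decide)) (anti 0 2 (by decide)) (anti 1 2 (by decide))
    (by omega) (by omega) (by omega)

theorem prism_of_two_edges (H : Pyramid G q c w) {ℓ m : ℕ} (hℓ : ℓ = 2 * m + 2) (hm : 2 ≤ m)
    {i k : Fin 3} (hik : i ≠ k) {y : V} {d e : ℕ} (hmd : m ≤ d) (hme : m ≤ e)
    (hd : d + 1 + 2 * m ≤ c i) (he : e + 1 + 2 * m ≤ c k)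
    (hyi : ∀ s ≤ c i, y ≠ q i s ∧ (G.Adj y (q i s) ↔ s = d ∨ s = d + 1))
    (hyk : ∀ s ≤ c k, y ≠ q k s ∧ (G.Adj y (q k s) ↔ s = e ∨ s = e + 1)) :
    HasPrism G ℓ (c i + c k + 2) := by
  have p2 : HasPath G (Seg (q i) (d + 1) (c i - 1) ∪ Seg (q k) (e + 1) (c k))
      (q i (d + 1)) (q k (e + 1)) (c i - 1 - (d + 1) + (c k - (e + 1)) + 1) := by
    refine (H.seg i (by omega) (by omega)).join (H.seg k (by omega) le_rfl).symm ?_ ?_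
    · rw [H.adj_iff hik] <;> omega
    · rintro _ ⟨r, h1, h2, rfl⟩ _ ⟨r', h1', h2', rfl⟩
      rw [ne_eq, H.eq_iff hik (by omega) (by omega), H.adj_iff hik (by omega) (by omega)
        (by omega) (by omega), H.eq_same (by omega) (by omega), H.eq_same (by omega) (by omega)]
      omega
  have p3 : HasPath G (Seg (q i) 0 d ∪ Seg (q k) 0 e) (q i d) (q k e) (d - 0 + (e - 0) + 1) := by
    refine (H.seg i (Nat.zero_le _) (by omega)).symm.join
        (H.seg k (Nat.zero_le _) (by omega)) ?_ ?_
    · rw [H.adj_iff hik] <;> omega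
    · rintro _ ⟨r, h1, h2, rfl⟩ _ ⟨r', h1', h2', rfl⟩
      rw [ne_eq, H.eq_iff hik (by omega) (by omega), H.adj_iff hik (by omega) (by omega)
        (by omega) (by omega), H.eq_same (by omega) (by omega), H.eq_same (by omega) (by omega)]
      omega
  have ai : ∀ s ≤ c i, s = d ∨ s = d + 1 → G.Adj y (q i s) := fun s hs => (hyi s hs).2.2
  have ak : ∀ s ≤ c k, s = e ∨ s = e + 1 → G.Adj y (q k s) := fun s hs => (hyk s hs).2.2
  have := hasPrism_of_rungs (ℓ := ℓ) (by omega) (HasPath.single y) p2 p3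
    ⟨ai _ (by omega) (by omega), ak _ (by omega) (by omega), ?_⟩
    ⟨ai _ (by omega) (by omega), ak _ (by omega) (by omega), ?_⟩
    ⟨?_, ?_, ?_⟩ (by omega) (by omega) (by omega)
  · convert this using 1
    omega
  · rintro _ rfl _ (⟨r, h1, h2, rfl⟩ | ⟨r, h1, h2, rfl⟩)
    · refine ⟨(hyi r (by omega)).1, fun h => .inl ⟨rfl, ?_⟩⟩
      have := (hyi r (by omega)).2.1 h
      rw [H.eq_same] <;> omega
    · refine ⟨(hyk r (by omega)).1, fun h => .inr ⟨rfl, ?_⟩⟩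
      have := (hyk r (by omega)).2.1 h
      rw [H.eq_same] <;> omega
  · rintro _ rfl _ (⟨r, h1, h2, rfl⟩ | ⟨r, h1, h2, rfl⟩)
    · refine ⟨(hyi r (by omega)).1, fun h => .inl ⟨rfl, ?_⟩⟩
      have := (hyi r (by omega)).2.1 h
      rw [H.eq_same] <;> omega
    · refine ⟨(hyk r (by omega)).1, fun h => .inr ⟨rfl, ?_⟩⟩
      have := (hyk r (by omega)).2.1 h
      rw [H.eq_same] <;> omega
  · rw [H.adj_same] <;> omega
  · rw [H.adj_same] <;> omega
  · rintro _ (⟨r, h1, h2, rfl⟩ | ⟨r, h1, h2, rfl⟩) _ (⟨r', h1', h2', rfl⟩ | ⟨r', h1', h2', rfl⟩)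
    · rw [ne_eq, H.eq_same (by omega) (by omega), H.adj_same (by omega) (by omega),
        H.eq_same (by omega) (by omega), H.eq_same (by omega) (by omega)]
      omega
    · rw [ne_eq, H.eq_iff hik (by omega) (by omega), H.adj_iff hik (by omega) (by omega)
        (by omega) (by omega)]
      omega
    · rw [ne_comm, ne_eq, H.eq_iff hik (by omega) (by omega), G.adj_comm,
        H.adj_iff hik (by omega) (by omega) (by omega) (by omega)]
      omega
    · rw [ne_eq, H.eq_same (by omega) (by omega), H.adj_same (by omega) (by omega),
        H.eq_same (by omega) (by omega), H.eq_same (by omega) (by omega)]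
      omega

end Pyramid

end Pyramids

end LEH

namespace LEH

namespace Pyramid

variable {V : Type*} {G : SimpleGraph V} {q : Fin 3 → ℕ → V} {c : Fin 3 → ℕ} {w : V}

theorem prism_of_attachment (H : Pyramid G q c w) {ℓ m : ℕ} (hℓ : ℓ = 2 * m + 2) (hm : 2 ≤ m)
    {i k h : Fin 3} (hik : i ≠ k) (hih : i ≠ h) (hkh : k ≠ h) {y : V} {d t n : ℕ} {S : Set V}
    {r₁ r₂ : V} (hmd : m ≤ d) (hd : d + 2 * m ≤ c i) (hmt : m ≤ t) (ht : t < c k)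
    (hch : m ≤ c h) (hl : ℓ ≤ c h + c k + 1)
    (hyi : ∀ s ≤ d, y ≠ q i s ∧ (G.Adj y (q i s) ↔ s = d))
    (hyk : ∀ s ≤ c k, y ≠ q k s ∧ ¬ G.Adj y (q k s))
    (hyh : ∀ s ≤ c h, y ≠ q h s ∧ ¬ G.Adj y (q h s))
    (hS : HasPath G S r₁ r₂ n) (hyr : G.Adj y r₁) (hr : G.Adj r₂ (q k t))
    (hr' : G.Adj r₂ (q k (t + 1))) (hSy : ∀ r ∈ S, y ≠ r ∧ (G.Adj y r → r = r₁))
    (hSq : ∀ r ∈ S, ∀ j, ∀ s ≤ c j, r ≠ q j s ∧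
      (G.Adj r (q j s) → r = r₂ ∧ (q j s = q k t ∨ q j s = q k (t + 1)))) :
    HasPrism G ℓ (d + n + c h + c k + 4) := by
  have p1 : HasPath G (Seg (q i) 0 d ∪ ({y} ∪ S)) (q i 0) r₂ (d - 0 + (0 + n + 1) + 1) := by
    refine (H.seg i (Nat.zero_le _) (by omega)).join ((HasPath.single y).join hS hyr ?_) ?_ ?_
    · rintro _ rfl r hr
      exact ⟨(hSy r hr).1, fun h => ⟨rfl, (hSy r hr).2 h⟩⟩
    · exact ((hyi d le_rfl).2.2 rfl).symm
    · rintro _ ⟨s, h1, h2, rfl⟩ r (rfl | hr)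
      · refine ⟨(hyi s h2).1.symm, fun h => ⟨?_, rfl⟩⟩
        rw [(hyi s h2).2.1 h.symm]
      · have := hSq r hr i s (by omega)
        refine ⟨this.1.symm, fun h => ?_⟩
        have := (this.2 h.symm).2
        rw [H.eq_iff hik (by omega) (by omega), H.eq_iff hik (by omega) (by omega)] at this
        omega
  have p2 := H.seg k (Nat.zero_le t) ht.le
  have p3 : HasPath G (Seg (q h) 0 (c h - 1) ∪ Seg (q k) (t + 1) (c k))
      (q h 0) (q k (t + 1)) (c h - 1 - 0 + (c k - (t + 1)) + 1) := by
    refine (H.seg h (Nat.zero_le _) (by omega)).join (H.seg k (by omega) le_rfl).symm ?_ ?_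
    · rw [H.adj_iff hkh.symm] <;> omega
    · rintro _ ⟨r, h1, h2, rfl⟩ _ ⟨r', h1', h2', rfl⟩
      rw [ne_eq, H.eq_iff hkh.symm (by omega) (by omega), H.adj_iff hkh.symm (by omega) (by omega)
        (by omega) (by omega), H.eq_same (by omega) (by omega), H.eq_same (by omega) (by omega)]
      omega
  have := hasPrism_of_rungs (ℓ := ℓ) (by omega) p1 p2 p3
    ⟨?_, hr, ?_⟩ ⟨?_, hr', ?_⟩ ⟨?_, ?_, ?_⟩ (by omega) (by omega) (by omega)
  · convert this using 1
    omega
  · rw [H.adj_iff hik] <;> omega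
  · rintro _ (⟨r, h1, h2, rfl⟩ | rfl | hz) _ ⟨r', h1', h2', rfl⟩
    · rw [ne_eq, H.eq_iff hik (by omega) (by omega), H.adj_iff hik (by omega) (by omega)
        (by omega) (by omega), H.eq_same (by omega) (by omega), H.eq_same (by omega) (by omega)]
      omega
    · exact ⟨(hyk r' (by omega)).1, fun h => ((hyk r' (by omega)).2 h).elim⟩
    · have := hSq _ hz k r' (by omega)
      refine ⟨this.1, fun h => .inr ⟨(this.2 h).1, ?_⟩⟩
      have := (this.2 h).2
      rw [H.eq_same (by omega) (by omega), H.eq_same (by omega) (by omega)] at this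
      rw [H.eq_same] <;> omega
  · rw [H.adj_iff hih] <;> omega
  · rintro _ (⟨r, h1, h2, rfl⟩ | rfl | hz) _ (⟨r', h1', h2', rfl⟩ | ⟨r', h1', h2', rfl⟩)
    · rw [ne_eq, H.eq_iff hih (by omega) (by omega), H.adj_iff hih (by omega) (by omega)
        (by omega) (by omega), H.eq_same (by omega) (by omega), H.eq_same (by omega) (by omega)]
      omega
    · rw [ne_eq, H.eq_iff hik (by omega) (by omega), H.adj_iff hik (by omega) (by omega)
        (by omega) (by omega), H.eq_same (by omega) (by omega), H.eq_same (by omega) (by omega)]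
      omega
    · exact ⟨(hyh r' (by omega)).1, fun h => ((hyh r' (by omega)).2 h).elim⟩
    · exact ⟨(hyk r' (by omega)).1, fun h => ((hyk r' (by omega)).2 h).elim⟩
    · have := hSq _ hz h r' (by omega)
      refine ⟨this.1, fun h => ?_⟩
      have := (this.2 h).2
      rw [H.eq_iff hkh.symm (by omega) (by omega), H.eq_iff hkh.symm (by omega) (by omega)] at this
      omega
    · have := hSq _ hz k r' (by omega)
      refine ⟨this.1, fun h => .inr ⟨(this.2 h).1, ?_⟩⟩
      have := (this.2 h).2
      rw [H.eq_same (by omega) (by omega), H.eq_same (by omega) (by omega)] at this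
      rw [H.eq_same] <;> omega
  · rw [H.adj_iff hkh] <;> omega
  · rw [H.adj_same] <;> omega
  · rintro _ ⟨r, h1, h2, rfl⟩ _ (⟨r', h1', h2', rfl⟩ | ⟨r', h1', h2', rfl⟩)
    · rw [ne_eq, H.eq_iff hkh (by omega) (by omega), H.adj_iff hkh (by omega) (by omega)
        (by omega) (by omega), H.eq_same (by omega) (by omega), H.eq_same (by omega) (by omega)]
      omega
    · rw [ne_eq, H.eq_same (by omega) (by omega), H.adj_same (by omega) (by omega),
        H.eq_same (by omega) (by omega), H.eq_same (by omega) (by omega),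
        H.eq_same (by omega) (by omega)]
      omega

end Pyramid

end LEH

namespace LEH

theorem exists_first_last {p : ℕ → Prop} {n : ℕ} (h : ∃ s ≤ n, p s) :
    ∃ d g, d ≤ g ∧ g ≤ n ∧ p d ∧ p g ∧ ∀ s ≤ n, p s → d ≤ s ∧ s ≤ g := by
  classical
  obtain ⟨s, hs, hps⟩ := h
  refine ⟨Nat.find ⟨s, hps⟩, Nat.findGreatest p n, ?_, Nat.findGreatest_le n,
    Nat.find_spec ⟨s, hps⟩, Nat.findGreatest_spec hs hps, fun t ht hpt =>
      ⟨Nat.find_min' _ hpt, Nat.le_findGreatest ht hpt⟩⟩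
  exact (Nat.find_min' _ hps).trans (Nat.le_findGreatest hs hps)

theorem exists_third {i k : Fin 3} (h : i ≠ k) : ∃ j, i ≠ j ∧ k ≠ j := by
  revert i k
  decide

theorem eq_or_eq_or_eq {i k h : Fin 3} (hik : i ≠ k) (hih : i ≠ h) (hkh : k ≠ h) (j : Fin 3) :
    j = i ∨ j = k ∨ j = h := by
  revert i k h j
  decide

theorem sum_three_eq (f : Fin 3 → ℕ) {i k h : Fin 3} (hik : i ≠ k) (hih : i ≠ h) (hkh : k ≠ h) :
    f i + f k + f h = f 0 + f 1 + f 2 := by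
  have : ({i, k, h} : Finset (Fin 3)) = Finset.univ := by
    revert i k h
    decide
  rw [← Fin.sum_univ_three, ← this, Finset.sum_insert (by simp [hik, hih]),
    Finset.sum_pair hkh, add_assoc]

variable {V : Type*} {G : SimpleGraph V}

/-- An induced path of length `n` leaves `y` and reaches the pyramid given by `q` and `c` off its
`i`-th path, at a single vertex or at the ends of an edge, far from the base. -/
def Detour (G : SimpleGraph V) (q : Fin 3 → ℕ → V) (c : Fin 3 → ℕ) (y : V) (m N : ℕ)
    (i : Fin 3) : Prop :=
  ∃ k, i ≠ k ∧ ∃ S r₁ r₂ n t, HasPath G S r₁ r₂ n ∧ G.Adj y r₁ ∧ G.Adj r₂ (q k t) ∧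
    m ≤ t ∧ t ≤ c k ∧ n + (c 0 + c 1 + c 2) + 6 < N ∧
    (∀ r ∈ S, y ≠ r ∧ (G.Adj y r → r = r₁)) ∧
    (∀ r ∈ S, ∀ j, ∀ s ≤ c j, r ≠ q j s) ∧
    ((∀ r ∈ S, ∀ j, ∀ s ≤ c j, G.Adj r (q j s) → r = r₂ ∧ q j s = q k t) ∨
      t < c k ∧ G.Adj r₂ (q k (t + 1)) ∧
      ∀ r ∈ S, ∀ j, ∀ s ≤ c j, G.Adj r (q j s) →
        r = r₂ ∧ (q j s = q k t ∨ q j s = q k (t + 1)))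

theorem Pyramid.exists_edge {q : Fin 3 → ℕ → V} {c : Fin 3 → ℕ} {w : V}
    (H : Pyramid G q c w) {ℓ m N : ℕ} (hℓ : ℓ = 2 * m + 2) (hm : 2 ≤ m)
    (hnt : ¬ HasLongTheta G ℓ) (hmin : ∀ N', HasPrism G ℓ N' → N ≤ N') {y : V}
    (hy : ∀ i, ∀ s ≤ c i, y ≠ q i s)
    (hyb : ∀ i, ∀ s ≤ c i, G.Adj y (q i s) → m ≤ s ∧ s + 2 * m ≤ c i)
    (hcm : ∀ i, m ≤ c i) (hcl : ∀ i k, i ≠ k → ℓ ≤ c i + c k + 1)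
    (hcN : ∀ i k, i ≠ k → c i + c k + 2 < N) (hne : ∃ i, ∃ s ≤ c i, G.Adj y (q i s))
    (hR : ∀ i, (∀ j, i ≠ j → ∀ s ≤ c j, ¬ G.Adj y (q j s)) → Detour G q c y m (N + ℓ) i) :
    ∃ i s, s + 1 ≤ c i ∧ G.Adj y (q i s) ∧ G.Adj y (q i (s + 1)) ∧
      ∀ j, ∀ t ≤ c j, G.Adj y (q j t) → q j t = q i s ∨ q j t = q i (s + 1) := by
  obtain ⟨i, hi⟩ := hne
  by_cases hk : ∃ k, i ≠ k ∧ ∃ s ≤ c k, G.Adj y (q k s)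
  · exfalso
    obtain ⟨k, hik, hk⟩ := hk
    obtain ⟨h, hih, hkh⟩ := exists_third hik
    by_cases hh : ∃ s ≤ c h, G.Adj y (q h s)
    · have all : ∀ j, ∃ s ≤ c j, G.Adj y (q j s) := by
        intro j
        obtain rfl | rfl | rfl := eq_or_eq_or_eq hik hih hkh j <;> assumption
      choose d g hdg hgc hd hg hs using fun j => exists_first_last (all j)
      refine hnt (H.theta_apex hℓ hm (fun j => (hyb j _ (hgc j) (hg j)).2) (fun j => ?_) hg
        (fun j s hsc => ⟨hy j s hsc, fun h => (hs j s hsc h).2⟩))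
      have := (hyb j _ (hgc j) (hg j)).1
      omega
    · push Not at hh
      have key : ∀ i k, i ≠ k → i ≠ h → k ≠ h → ∀ d g f, d ≤ g → g ≤ c i → f ≤ c k →
          G.Adj y (q i d) → G.Adj y (q i g) → G.Adj y (q k f) →
          (∀ s ≤ c i, G.Adj y (q i s) → d ≤ s ∧ s ≤ g) →
          (∀ s ≤ c k, G.Adj y (q k s) → s ≤ f) → g = d + 1 := by
        intro i k hik hih hkh d g f hdg hgc hfc hd hg hf hs hsf
        by_contra hgd
        have b1 := hyb i d (by omega) hd
        have b2 := hyb i g hgc hg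
        have b3 := hyb k f hfc hf
        have ch := hcm h
        refine hnt (H.theta_of_attachment hℓ hm hih b1.1 hdg hgd b2.2 ch le_rfl hd hg
          (fun s hsc => ⟨hy i s hsc, hs s hsc⟩) (fun s hsc => ⟨hy h s hsc, hh s hsc⟩)
          (H.seg k (s := f) (t := c k - 1) (by omega) (by omega)) hf ?_ ?_ ?_ ?_)
        · rw [H.adj_iff hkh] <;> omega
        · rintro _ ⟨r, h1, h2, rfl⟩
          refine ⟨hy k r (by omega), fun hr => ?_⟩
          have := hsf r (by omega) hr
          rw [le_antisymm this h1]
        · rintro _ ⟨r, h1, h2, rfl⟩ s hs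
          rw [ne_eq, H.eq_iff hik.symm (by omega) (by omega), H.adj_iff hik.symm (by omega)
            (by omega) (by omega) (by omega)]
          omega
        · rintro _ ⟨r, h1, h2, rfl⟩ s hs
          rw [ne_eq, H.eq_iff hkh (by omega) (by omega), H.adj_iff hkh (by omega) (by omega)
            (by omega) (by omega), H.eq_same (by omega) (by omega)]
          omega
      obtain ⟨d, g, hdg, hgc, hd, hg, hs⟩ := exists_first_last hi
      obtain ⟨e, f, hef, hfc, he, hf, hs'⟩ := exists_first_last hk
      obtain rfl := key i k hik hih hkh d g f hdg hgc hfc hd hg hf hs fun s h1 h2 => (hs' s h1 h2).2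
      obtain rfl := key k i hik.symm hkh hih e f _ hef hfc hgc he hf hg hs'
        fun s h1 h2 => (hs s h1 h2).2
      have b1 := hyb i d (by omega) hd
      have b2 := hyb i _ hgc hg
      have b3 := hyb k e (by omega) he
      have b4 := hyb k _ hfc hf
      have := hmin _ (H.prism_of_two_edges hℓ hm hik b1.1 b3.1 b2.2 b4.2
        (fun s hsc => ⟨hy i s hsc, fun h => ?_, ?_⟩) (fun s hsc => ⟨hy k s hsc, fun h => ?_, ?_⟩))
      · have := hcN i k hik
        omega
      · have := hs s hsc h
        omega
      · rintro (rfl | rfl) <;> assumption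
      · have := hs' s hsc h
        omega
      · rintro (rfl | rfl) <;> assumption
  · have hk' : ∀ j, i ≠ j → ∀ s ≤ c j, ¬ G.Adj y (q j s) := fun j hij s hs hadj =>
      hk ⟨j, hij, s, hs, hadj⟩
    obtain ⟨d, g, hdg, hgc, hd, hg, hs⟩ := exists_first_last hi
    have b1 := hyb i d (by omega) hd
    have b2 := hyb i g hgc hg
    by_cases hgd : g = d + 1
    · subst hgd
      refine ⟨i, d, hgc, hd, hg, fun j t ht hadj => ?_⟩
      by_cases hij : i = j
      · subst hij
        have := hs t ht hadj
        obtain rfl | rfl : t = d ∨ t = d + 1 := by omega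
        · exact .inl rfl
        · exact .inr rfl
      · exact (hk' j hij t ht hadj).elim
    · exfalso
      obtain ⟨k, hik, S, r₁, r₂, n, t, hS, h1, h2, hmt, htk, hn, hSy, hSq, h | ⟨h3, h4, h⟩⟩ :=
        hR i hk'
      · refine hnt (H.theta_of_attachment hℓ hm hik b1.1 hdg hgd b2.2 hmt htk hd hg
          (fun s hsc => ⟨hy i s hsc, hs s hsc⟩) (fun s hsc => ⟨hy k s hsc, hk' k hik s hsc⟩) hS
          h1 h2 hSy (fun r hr s hsc => ⟨hSq r hr i s hsc.le, fun hadj => ?_⟩)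
          (fun r hr s hsc => ⟨hSq r hr k s hsc, fun hadj => ?_⟩))
        · have := (h r hr i s hsc.le hadj).2
          rw [H.eq_iff hik hsc.le htk] at this
          omega
        · have := h r hr k s hsc hadj
          rwa [H.eq_same hsc htk] at this
      · obtain ⟨j, hij, hkj⟩ := exists_third hik
        have := hmin _ (H.prism_of_attachment hℓ hm hik hij hkj b1.1 b1.2 hmt h3 (hcm j)
          (by have := hcl k j hkj; omega) (fun s hsc => ⟨hy i s (by omega), fun hadj => ?_, ?_⟩)
          (fun s hsc => ⟨hy k s hsc, hk' k hik s hsc⟩) (fun s hsc => ⟨hy j s hsc, hk' j hij s hsc⟩)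
          hS h1 h2 h4 hSy (fun r hr j s hsc => ⟨hSq r hr j s hsc, h r hr j s hsc⟩))
        · have := sum_three_eq c hik hij hkj
          omega
        · have := hs s (by omega) hadj
          omega
        · rintro rfl
          exact hd

end LEH

namespace LEH

variable {V : Type*} {G : SimpleGraph V}

theorem Detour.of_path {q : Fin 3 → ℕ → V} {c : Fin 3 → ℕ} {x y : V} {m N L t : ℕ} {i k : Fin 3}
    (hik : i ≠ k) {f : ℕ → V} (hne : ∀ r r', r < r' → r' ≤ L → f r ≠ f r')
    (hadj : ∀ r r', r < r' → r' ≤ L → (G.Adj (f r) (f r') ↔ r + 1 = r'))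
    (hx : ∀ r ≤ L, y ≠ f r) (hyf : ∃ r, 1 ≤ r ∧ r ≤ L ∧ G.Adj y (f r))
    (hmt : m ≤ t) (ht : t < c k) (hqt : q k t = f 0) (hqt' : q k (t + 1) = x)
    (hq : ∀ r, 1 ≤ r → r ≤ L → ∀ j, ∀ s ≤ c j, f r ≠ q j s ∧
      (G.Adj (f r) (q j s) → q j s = x ∨ q j s = f 0 ∧ r = 1))
    (hN : L + (c 0 + c 1 + c 2) + 5 < N) : Detour G q c y m N i := by
  classical
  obtain ⟨hu1, hu2, hu3⟩ := Nat.find_spec hyf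
  have humin : ∀ r, 1 ≤ r → r ≤ L → G.Adj y (f r) → Nat.find hyf ≤ r :=
    fun r h1 h2 h3 => Nat.find_min' hyf ⟨h1, h2, h3⟩
  generalize Nat.find hyf = u at *
  obtain ⟨_, v, -, hvu, -, ⟨hv1, hv⟩, hvmax⟩ := exists_first_last
    (p := fun r => 1 ≤ r ∧ (r = 1 ∨ G.Adj x (f r))) (n := u) ⟨1, hu1, le_rfl, .inl rfl⟩
  have hS : HasPath G (Seg f v u) (f u) (f v) (u - v) :=
    (HasPath.seg hvu (fun r r' _ h2 h3 => hne r r' h2 (by omega))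
      (fun r r' _ h2 h3 => hadj r r' h2 (by omega))).symm
  have hSy : ∀ r ∈ Seg f v u, y ≠ r ∧ (G.Adj y r → r = f u) := by
    rintro _ ⟨r, h1, h2, rfl⟩
    refine ⟨hx r (by omega), fun h => ?_⟩
    rw [le_antisymm h2 (humin r (by omega) (by omega) h)]
  have hSq : ∀ r ∈ Seg f v u, ∀ j, ∀ s ≤ c j, r ≠ q j s := by
    rintro _ ⟨r, h1, h2, rfl⟩ j s hs
    exact (hq r (by omega) (by omega) j s hs).1
  have hSa : ∀ r ∈ Seg f v u, ∀ j, ∀ s ≤ c j, G.Adj r (q j s) →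
      r = f v ∧ (q j s = x ∧ G.Adj x (f v) ∨ q j s = f 0 ∧ v = 1) := by
    rintro _ ⟨r, h1, h2, rfl⟩ j s hs h
    rcases (hq r (by omega) (by omega) j s hs).2 h with h' | ⟨h', rfl⟩
    · rw [h'] at h
      obtain rfl := le_antisymm (hvmax r h2 ⟨by omega, .inr h.symm⟩).2 h1
      exact ⟨rfl, .inl ⟨h', h.symm⟩⟩
    · obtain rfl : v = 1 := by omega
      exact ⟨rfl, .inr ⟨h', rfl⟩⟩
  have h01 : G.Adj (f 1) (f 0) := ((hadj 0 1 (by omega) (by omega)).2 rfl).symm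
  refine ⟨k, hik, Seg f v u, f u, f v, u - v, ?_⟩
  by_cases hv1 : v = 1
  · subst hv1
    refine ⟨t, hS, hu3, by rwa [hqt], hmt, ht.le, by omega, hSy, hSq, ?_⟩
    by_cases hx1 : G.Adj x (f 1)
    · refine .inr ⟨ht, by rw [hqt']; exact hx1.symm, fun r hr j s hs h => ?_⟩
      rw [hqt, hqt']
      have := hSa r hr j s hs h
      tauto
    · refine .inl fun r hr j s hs h => ?_
      rw [hqt]
      have := hSa r hr j s hs h
      tauto
  · have hxv := hv.resolve_left hv1
    refine ⟨t + 1, hS, hu3, by rw [hqt']; exact hxv.symm, by omega, ht, by omega, hSy, hSq,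
      .inl fun r hr j s hs h => ?_⟩
    rw [hqt']
    have := hSa r hr j s hs h
    tauto

/-- The vertices `f 0, …, f c = w` form an induced path in this order. -/
structure PathTo (G : SimpleGraph V) (f : ℕ → V) (c : ℕ) (w : V) : Prop where
  last : f c = w
  ne : ∀ s t, s < t → t ≤ c → f s ≠ f t
  adj : ∀ s t, s < t → t ≤ c → (G.Adj (f s) (f t) ↔ s + 1 = t)

/-- Away from their last vertices, the paths `f` and `f'` are disjoint and `f 0` and `f' 0` is the
only edge between them. -/
def MeetAtEnds (G : SimpleGraph V) (f : ℕ → V) (c : ℕ) (f' : ℕ → V) (c' : ℕ) : Prop :=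
  ∀ s t, s < c → t < c' → f s ≠ f' t ∧ (G.Adj (f s) (f' t) ↔ s = 0 ∧ t = 0)

theorem MeetAtEnds.symm {f f' : ℕ → V} {c c' : ℕ} (h : MeetAtEnds G f c f' c') :
    MeetAtEnds G f' c' f c := by
  intro s t hs ht
  rw [ne_comm, G.adj_comm, (h t s ht hs).2, and_comm (a := t = 0)]
  exact ⟨(h t s ht hs).1, Iff.rfl⟩

theorem Pyramid.of_three {f₁ f₂ f₃ : ℕ → V} {c₁ c₂ c₃ : ℕ} {w : V}
    (h₁ : PathTo G f₁ c₁ w) (h₂ : PathTo G f₂ c₂ w) (h₃ : PathTo G f₃ c₃ w)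
    (h₁₂ : MeetAtEnds G f₁ c₁ f₂ c₂) (h₁₃ : MeetAtEnds G f₁ c₁ f₃ c₃)
    (h₂₃ : MeetAtEnds G f₂ c₂ f₃ c₃) : Pyramid G ![f₁, f₂, f₃] ![c₁, c₂, c₃] w := by
  have key : ∀ i, PathTo G ((![f₁, f₂, f₃] : Fin 3 → ℕ → V) i)
      ((![c₁, c₂, c₃] : Fin 3 → ℕ) i) w := by
    intro i
    fin_cases i <;> assumption
  refine ⟨fun i => (key i).last, fun i => (key i).ne, fun i => (key i).adj, ?_⟩
  have cross : ∀ i j, i ≠ j → MeetAtEnds G ((![f₁, f₂, f₃] : Fin 3 → ℕ → V) i)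
      ((![c₁, c₂, c₃] : Fin 3 → ℕ) i) ((![f₁, f₂, f₃] : Fin 3 → ℕ → V) j)
      ((![c₁, c₂, c₃] : Fin 3 → ℕ) j) := by
    intro i j hij
    fin_cases i <;> fin_cases j
    · exact (hij rfl).elim
    · exact h₁₂
    · exact h₁₃
    · exact h₁₂.symm
    · exact (hij rfl).elim
    · exact h₂₃
    · exact h₁₃.symm
    · exact h₂₃.symm
    · exact (hij rfl).elim
  exact fun i j s t hij => cross i j hij s t

theorem exists_other : ∀ i : Fin 3, ∃ k, i ≠ k := by
  decide

/-- `p i 0, …, p i (n i)`, for `i : Fin 3`, are the constituent paths of an induced near-prism, at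
most one of which has length less than `ℓ`. -/
structure IndexedPrism (G : SimpleGraph V) (ℓ : ℕ) (p : Fin 3 → ℕ → V) (n : Fin 3 → ℕ) :
    Prop where
  ne : ∀ i s t, s < t → t ≤ n i → p i s ≠ p i t
  adj : ∀ i s t, s < t → t ≤ n i → (G.Adj (p i s) (p i t) ↔ s + 1 = t)
  cross : ∀ i j s t, i ≠ j → s ≤ n i → t ≤ n j →
    p i s ≠ p j t ∧ (G.Adj (p i s) (p j t) ↔ s = 0 ∧ t = 0 ∨ s = n i ∧ t = n j)
  long : ∀ i j, i ≠ j → ℓ ≤ n i ∨ ℓ ≤ n j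

/-- `x` is a vertex outside the near-prism, with no neighbour among the first and last `m`
vertices of its paths, nor on paths that are not long, and its neighbours on the near-prism do not
lie on a short subpath of a constituent path. -/
structure Spread (G : SimpleGraph V) (ℓ m : ℕ) (p : Fin 3 → ℕ → V) (n : Fin 3 → ℕ) (x : V) :
    Prop where
  ne : ∀ i, ∀ s ≤ n i, x ≠ p i s
  mid : ∀ i, ∀ s ≤ n i, G.Adj x (p i s) → m ≤ s ∧ s + m ≤ n i ∧ ℓ ≤ n i
  far : ∀ i, (∀ j, i ≠ j → ∀ s ≤ n j, ¬ G.Adj x (p j s)) →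
    ∃ s t, s + 3 ≤ t ∧ t ≤ n i ∧ G.Adj x (p i s) ∧ G.Adj x (p i t)

namespace IndexedPrism

variable {ℓ m : ℕ} {p : Fin 3 → ℕ → V} {n : Fin 3 → ℕ}

theorem adj_same (K : IndexedPrism G ℓ p n) {i : Fin 3} {s t : ℕ} (hs : s ≤ n i) (ht : t ≤ n i) :
    G.Adj (p i s) (p i t) ↔ s + 1 = t ∨ t + 1 = s := by
  rcases lt_trichotomy s t with h | rfl | h
  · rw [K.adj i s t h ht]
    omega
  · simp
  · rw [G.adj_comm, K.adj i t s h hs]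
    omega

theorem eq_same (K : IndexedPrism G ℓ p n) {i : Fin 3} {s t : ℕ} (hs : s ≤ n i) (ht : t ≤ n i) :
    p i s = p i t ↔ s = t := by
  rcases lt_trichotomy s t with h | rfl | h
  · exact iff_of_false (K.ne i s t h ht) (by omega)
  · simp
  · exact iff_of_false (K.ne i t s h hs).symm (by omega)

theorem adj_cross (K : IndexedPrism G ℓ p n) {i j : Fin 3} (hij : i ≠ j) {s t : ℕ} (hs : s ≤ n i)
    (ht : t ≤ n j) : G.Adj (p i s) (p j t) ↔ s = 0 ∧ t = 0 ∨ s = n i ∧ t = n j :=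
  (K.cross i j s t hij hs ht).2

theorem ne_and_imp_iff (K : IndexedPrism G ℓ p n) {i j : Fin 3} (hij : i ≠ j) {s t : ℕ}
    (hs : s ≤ n i) (ht : t ≤ n j) {Q : Prop} :
    p i s ≠ p j t ∧ (G.Adj (p i s) (p j t) → Q) ↔
      (s = 0 ∧ t = 0 ∨ s = n i ∧ t = n j → Q) := by
  rw [(K.cross i j s t hij hs ht).2]
  exact and_iff_right (K.cross i j s t hij hs ht).1

theorem seg (K : IndexedPrism G ℓ p n) (i : Fin 3) {s t : ℕ} (hst : s ≤ t) (ht : t ≤ n i) :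
    HasPath G (Seg (p i) s t) (p i s) (p i t) (t - s) :=
  .seg hst (fun r r' _ h2 h3 => K.ne i r r' h2 (by omega))
    (fun r r' _ h2 h3 => K.adj i r r' h2 (by omega))

variable {x : V}

theorem exists_nbr_ne (K : IndexedPrism G ℓ p n) (X : Spread G ℓ m p n x) (hℓ : ℓ = 2 * m + 2)
    (hm : 2 ≤ m) (hmin : ∀ N, HasPrism G ℓ N → n 0 + n 1 + n 2 + 3 ≤ N) (i : Fin 3) :
    ∃ k, i ≠ k ∧ ∃ s ≤ n k, G.Adj x (p k s) := by
  by_contra! hno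
  obtain ⟨s, t, hst, htn, hxs, hxt⟩ := X.far i hno
  obtain ⟨d, g, hdg, hgn, hd, hg, hdg'⟩ :=
    exists_first_last (p := fun s => G.Adj x (p i s)) ⟨t, htn, hxt⟩
  have b1 := X.mid i d (by omega) hd
  have b2 := X.mid i g hgn hg
  have b3 := hdg' s (by omega) hxs
  have b4 := hdg' t htn hxt
  obtain ⟨k, hik⟩ := exists_other i
  obtain ⟨h, hih, hkh⟩ := exists_third hik
  have b5 := K.long k h hkh
  have p1 : HasPath G (Seg (p i) 0 d ∪ ({x} ∪ Seg (p i) g (n i))) (p i 0) (p i (n i))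
      (d - 0 + (0 + (n i - g) + 1) + 1) := by
    refine (K.seg i (Nat.zero_le _) (by omega)).join
      ((HasPath.single x).join (K.seg i hgn le_rfl) hg ?_) hd.symm ?_
    · rintro _ rfl _ ⟨r, h1, h2, rfl⟩
      refine ⟨X.ne i r h2, fun h => ⟨rfl, ?_⟩⟩
      rw [le_antisymm (hdg' r h2 h).2 h1]
    · rintro _ ⟨r, h1, h2, rfl⟩ _ (rfl | ⟨r', h1', h2', rfl⟩)
      · refine ⟨(X.ne i r (by omega)).symm, fun h => ⟨?_, rfl⟩⟩
        rw [le_antisymm (hdg' r (by omega) h.symm).1 h2]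
      · rw [ne_eq, K.eq_same (by omega) (by omega), K.adj_same (by omega) (by omega)]
        omega
  have rung : ∀ k, i ≠ k → Rungs G (Seg (p i) 0 d ∪ ({x} ∪ Seg (p i) g (n i)))
      (Seg (p k) 0 (n k)) (p i 0) (p i (n i)) (p k 0) (p k (n k)) := by
    intro k hik
    refine ⟨?_, ?_, ?_⟩
    · rw [K.adj_cross hik] <;> omega
    · rw [K.adj_cross hik] <;> omega
    · rintro _ (⟨r, h1, h2, rfl⟩ | rfl | ⟨r, h1, h2, rfl⟩) _ ⟨r', h1', h2', rfl⟩
      · rw [K.ne_and_imp_iff hik (by omega) (by omega),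
          K.eq_same (by omega) (by omega), K.eq_same (by omega) (by omega),
          K.eq_same (by omega) (by omega), K.eq_same (by omega) (by omega)]
        omega
      · exact ⟨X.ne k r' h2', fun h => (hno k hik r' h2' h).elim⟩
      · rw [K.ne_and_imp_iff hik (by omega) (by omega),
          K.eq_same (by omega) (by omega), K.eq_same (by omega) (by omega),
          K.eq_same (by omega) (by omega), K.eq_same (by omega) (by omega)]
        omega
  have rkh : Rungs G (Seg (p k) 0 (n k)) (Seg (p h) 0 (n h)) (p k 0) (p k (n k))
      (p h 0) (p h (n h)) := by
    refine ⟨?_, ?_, ?_⟩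
    · rw [K.adj_cross hkh] <;> omega
    · rw [K.adj_cross hkh] <;> omega
    · rintro _ ⟨r, h1, h2, rfl⟩ _ ⟨r', h1', h2', rfl⟩
      rw [K.ne_and_imp_iff hkh (by omega) (by omega),
        K.eq_same (by omega) (by omega), K.eq_same (by omega) (by omega),
        K.eq_same (by omega) (by omega), K.eq_same (by omega) (by omega)]
      omega
  have := hmin _ (hasPrism_of_rungs (by omega) p1 (K.seg k (Nat.zero_le _) le_rfl)
    (K.seg h (Nat.zero_le _) le_rfl) (rung k hik) (rung h hih) rkh (by omega) (by omega)
    (by omega))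
  have := sum_three_eq n hik hih hkh
  omega

theorem last_nbr_ne_succ (K : IndexedPrism G ℓ p n) (X : Spread G ℓ m p n x) (hℓ : ℓ = 2 * m + 2)
    (hm : 2 ≤ m) (hmin : ∀ N, HasPrism G ℓ N → n 0 + n 1 + n 2 + 3 ≤ N) {j k h : Fin 3}
    (hjk : j ≠ k) (hjh : j ≠ h) (hkh : k ≠ h) {s s' : ℕ}
    (hsn : s + 1 ≤ n j) (hs : G.Adj x (p j s)) (hs1 : G.Adj x (p j (s + 1)))
    (hsj : ∀ r ≤ n j, G.Adj x (p j r) → s ≤ r ∧ r ≤ s + 1)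
    (hs'n : s' ≤ n k) (hs' : G.Adj x (p k s')) (hsk : ∀ r ≤ n k, G.Adj x (p k r) → s' ≤ r)
    (hxh : ∀ r ≤ n h, ¬ G.Adj x (p h r)) : False := by
  have b1 := X.mid j s (by omega) hs
  have b2 := X.mid j _ hsn hs1
  have b3 := X.mid k s' hs'n hs'
  have p2 : HasPath G (Seg (p k) 0 s' ∪ {x}) (p k 0) x (s' - 0 + 0 + 1) := by
    refine (K.seg k (Nat.zero_le _) (by omega)).join (.single x) hs'.symm ?_
    rintro _ ⟨r, h1, h2, rfl⟩ _ rfl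
    refine ⟨(X.ne k r (by omega)).symm, fun h => ⟨?_, rfl⟩⟩
    rw [le_antisymm h2 (hsk r (by omega) h.symm)]
  have p3 : HasPath G (Seg (p h) 0 (n h) ∪ Seg (p j) (s + 1) (n j)) (p h 0) (p j (s + 1))
      (n h - 0 + (n j - (s + 1)) + 1) := by
    refine (K.seg h (Nat.zero_le _) le_rfl).join (K.seg j hsn le_rfl).symm ?_ ?_
    · rw [K.adj_cross hjh.symm] <;> omega
    · rintro _ ⟨r, h1, h2, rfl⟩ _ ⟨r', h1', h2', rfl⟩
      rw [K.ne_and_imp_iff hjh.symm (by omega) (by omega), K.eq_same (by omega) (by omega),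
        K.eq_same (by omega) (by omega)]
      omega
  have := hmin _ (hasPrism_of_rungs (ℓ := ℓ) (by omega) (K.seg j (Nat.zero_le s) (by omega)) p2 p3
    ⟨?_, hs.symm, ?_⟩ ⟨?_, ?_, ?_⟩ ⟨?_, hs1, ?_⟩ (by omega) (by omega) (by omega))
  · have := sum_three_eq n hjk hjh hkh
    omega
  · rw [K.adj_cross hjk] <;> omega
  · rintro _ ⟨r, h1, h2, rfl⟩ _ (⟨r', h1', h2', rfl⟩ | rfl)
    · rw [K.ne_and_imp_iff hjk (by omega) (by omega), K.eq_same (by omega) (by omega),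
        K.eq_same (by omega) (by omega)]
      omega
    · refine ⟨(X.ne j r (by omega)).symm, fun h => .inr ⟨?_, rfl⟩⟩
      rw [le_antisymm h2 (hsj r (by omega) h.symm).1]
  · rw [K.adj_cross hjh] <;> omega
  · rw [K.adj_same] <;> omega
  · rintro _ ⟨r, h1, h2, rfl⟩ _ (⟨r', h1', h2', rfl⟩ | ⟨r', h1', h2', rfl⟩)
    · rw [K.ne_and_imp_iff hjh (by omega) (by omega), K.eq_same (by omega) (by omega),
        K.eq_same (by omega) (by omega)]
      omega
    · rw [ne_eq, K.eq_same (by omega) (by omega), K.adj_same (by omega)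
        (by omega), K.eq_same (by omega) (by omega), K.eq_same (by omega) (by omega),
        K.eq_same (by omega) (by omega)]
      omega
  · rw [K.adj_cross hkh] <;> omega
  · rintro _ (⟨r, h1, h2, rfl⟩ | rfl) _ (⟨r', h1', h2', rfl⟩ | ⟨r', h1', h2', rfl⟩)
    · rw [K.ne_and_imp_iff hkh (by omega) (by omega), K.eq_same (by omega) (by omega),
        K.eq_same (by omega) (by omega)]
      omega
    · rw [K.ne_and_imp_iff hjk.symm (by omega) (by omega)]
      omega
    · exact ⟨X.ne h r' h2', fun hh => (hxh r' h2' hh).elim⟩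
    · refine ⟨X.ne j r' h2', fun h => .inr ⟨rfl, ?_⟩⟩
      rw [le_antisymm (hsj r' (by omega) h).2 h1']

end IndexedPrism

end LEH

namespace LEH

variable {V : Type*} {G : SimpleGraph V} {ℓ m : ℕ} {p : Fin 3 → ℕ → V} {n : Fin 3 → ℕ} {x y : V}

/-- `y` is distant from `x`, in terms of indices. -/
structure Apart (G : SimpleGraph V) (m : ℕ) (p : Fin 3 → ℕ → V) (n : Fin 3 → ℕ) (x y : V) :
    Prop where
  nadj : ¬ G.Adj x y
  first : ∀ i, ∀ s ≤ n i, G.Adj x (p i s) → (∀ r < s, ¬ G.Adj x (p i r)) →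
    ∀ r ≤ n i, s ≤ r + 2 * m → r ≤ s + 1 → ¬ G.Adj y (p i r)
  skip : ∀ i, (∀ s ≤ n i, ¬ G.Adj x (p i s)) → ∃ j, i ≠ j ∧
    ∀ s ≤ n j, G.Adj x (p j s) → (∀ r, s < r → r ≤ n j → ¬ G.Adj x (p j r)) →
      ∀ r ≤ n j, s ≤ r → r < s + 2 * m → ¬ G.Adj y (p j r)

/-- The vertices of the near-prism that come no later than the first neighbour of `x` on their
constituent path. -/
def UpToFirst (G : SimpleGraph V) (p : Fin 3 → ℕ → V) (n : Fin 3 → ℕ) (x : V) : Set V :=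
  {z | ∃ i, ∃ r ≤ n i, (∀ r' < r, ¬ G.Adj x (p i r')) ∧ z = p i r}

namespace IndexedPrism

theorem edge_of_forall_nbr (K : IndexedPrism G ℓ p n) (X : Spread G ℓ m p n x)
    (Y : Spread G ℓ m p n y) (D : Apart G m p n x y) (hℓ : ℓ = 2 * m + 2) (hm : 2 ≤ m)
    (hnt : ¬ HasLongTheta G ℓ) (hmin : ∀ N, HasPrism G ℓ N → n 0 + n 1 + n 2 + 3 ≤ N)
    (hyA : ∃ z ∈ UpToFirst G p n x, G.Adj y z) (hx : ∀ i, ∃ s ≤ n i, G.Adj x (p i s)) :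
    ∃ z₁ z₂, z₁ ∈ UpToFirst G p n x ∧ z₂ ∈ UpToFirst G p n x ∧ z₁ ≠ z₂ ∧
      G.Adj y z₁ ∧ G.Adj y z₂ ∧ G.Adj z₁ z₂ ∧
      ∀ z ∈ UpToFirst G p n x, G.Adj y z → z = z₁ ∨ z = z₂ := by
  choose s g hsg hgn hs hg hsm using fun i => exists_first_last (hx i)
  have hsn : ∀ i, s i + m ≤ n i ∧ m ≤ s i ∧ ℓ ≤ n i := fun i => by
    have := X.mid i (s i) ((hsg i).trans (hgn i)) (hs i)
    omega
  have hsf : ∀ i, ∀ r < s i, ¬ G.Adj x (p i r) := fun i r hr h => by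
    have := (hsm i r (by have := hsn i; omega) h).1
    omega
  have hsl : ∀ i, ∀ r ≤ s i, G.Adj x (p i r) ↔ r = s i := fun i r hr => by
    refine ⟨fun h => ?_, fun h => h ▸ hs i⟩
    have := hsf i r
    by_contra hne
    exact this (by omega) h
  have hnear : ∀ i, ∀ r ≤ n i, s i ≤ r + 2 * m → r ≤ s i + 1 → ¬ G.Adj y (p i r) :=
    fun i => D.first i (s i) (by have := hsn i; omega) (hs i) (hsf i)
  set q : Fin 3 → ℕ → V := fun i r => if r ≤ s i then p i r else x with hq
  set c : Fin 3 → ℕ := fun i => s i + 1 with hc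
  have q1 : ∀ i, ∀ r ≤ s i, q i r = p i r := fun i r hr => if_pos hr
  have q2 : ∀ i, q i (s i + 1) = x := fun i => if_neg (by omega)
  have qA : ∀ i, ∀ r ≤ c i, q i r = x ∨ q i r ∈ UpToFirst G p n x := by
    intro i r hr
    rcases Nat.le_or_eq_of_le_succ hr with h | rfl
    · have := hsn i
      exact .inr ⟨i, r, by omega, fun r' hr' => hsf i r' (by omega), q1 i r h⟩
    · exact .inl (q2 i)
  have H : Pyramid G q c x := by
    refine ⟨q2, ?_, ?_, ?_⟩
    · intro i r t hrt ht
      have := hsn i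
      rw [q1 i r (by simp only [hc] at ht; omega)]
      rcases Nat.le_or_eq_of_le_succ ht with h | rfl
      · rw [q1 i t h]
        exact K.ne i r t hrt (by omega)
      · rw [q2 i]
        exact (X.ne i r (by omega)).symm
    · intro i r t hrt ht
      have := hsn i
      rw [q1 i r (by simp only [hc] at ht; omega)]
      rcases Nat.le_or_eq_of_le_succ ht with h | rfl
      · rw [q1 i t h]
        exact K.adj i r t hrt (by omega)
      · rw [q2 i, G.adj_comm, hsl i r (by omega)]
        omega
    · intro i j r t hij hr ht
      have := hsn i
      have := hsn j
      rw [q1 i r (Nat.le_of_lt_succ hr), q1 j t (Nat.le_of_lt_succ ht)]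
      simp only [hc] at hr ht
      have := K.cross i j r t hij (by omega) (by omega)
      refine ⟨this.1, this.2.trans ?_⟩
      omega
  have hyq : ∀ i, ∀ r ≤ c i, y ≠ x → y ≠ q i r := by
    intro i r hr hyx
    have := hsn i
    rcases Nat.le_or_eq_of_le_succ hr with h | rfl
    · rw [q1 i r h]
      exact Y.ne i r (by omega)
    · rwa [q2 i]
  have hyx : y ≠ x := by
    rintro rfl
    exact hnear 0 (s 0) (by have := hsn 0; omega) (by omega) (by omega) (hs 0)
  have hya : ∀ i, ∀ r ≤ c i, G.Adj y (q i r) → r + 2 * m + 1 ≤ s i ∧ m ≤ r ∧ q i r = p i r := by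
    intro i r hr h
    have := hsn i
    rcases Nat.le_or_eq_of_le_succ hr with h' | rfl
    · rw [q1 i r h'] at h
      have b1 := hnear i r (by omega)
      have b2 := Y.mid i r (by omega) h
      refine ⟨?_, b2.1, q1 i r h'⟩
      by_contra hlt
      exact b1 (by omega) (by omega) h
    · rw [q2 i] at h
      exact (D.nadj h.symm).elim
  have hdet : ∀ i, (∀ j, i ≠ j → ∀ r ≤ c j, ¬ G.Adj y (q j r)) →
      Detour G q c y m (n 0 + n 1 + n 2 + 3 + ℓ) i := by
    intro i hi
    obtain ⟨k, hik, t, htn, ht⟩ := K.exists_nbr_ne Y hℓ hm hmin i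
    have b1 := hsn k
    have b2 := Y.mid k t htn ht
    have b3 : s k < t := by
      by_contra hlt
      have := hi k hik t (by simp only [hc]; omega)
      rw [q1 k t (by omega)] at this
      exact this ht
    refine Detour.of_path (f := fun r => p k (s k + r)) (L := n k - m - s k) (t := s k) (x := x)
      hik ?_ ?_ ?_ ?_ (by omega) (Nat.lt_succ_self _) (q1 k _ le_rfl) (q2 k) ?_ ?_
    · intro r r' h1 h2
      exact K.ne k _ _ (by omega) (by omega)
    · intro r r' h1 h2
      rw [K.adj k _ _ (by omega) (by omega)]
      omega
    · intro r hr
      exact Y.ne k _ (by omega)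
    · exact ⟨t - s k, by omega, by omega, by rwa [Nat.add_sub_cancel' b3.le]⟩
    · intro r h1 h2 j t hj
      have := hsn j
      rcases Nat.le_or_eq_of_le_succ hj with h' | rfl
      · rw [q1 j t h']
        by_cases hkj : k = j
        · subst hkj
          rw [ne_eq, K.eq_same (by omega) (by omega), K.adj_same (by omega) (by omega)]
          refine ⟨by omega, fun h => .inr ⟨?_, by omega⟩⟩
          congr 1
          omega
        · rw [K.ne_and_imp_iff hkj (by omega) (by omega)]
          omega
      · rw [q2 j]
        exact ⟨(X.ne k _ (by omega)).symm, fun _ => .inl rfl⟩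
    · have := hsn 0
      have := hsn 1
      have := hsn 2
      simp only [hc]
      obtain rfl | rfl | rfl := eq_or_eq_or_eq (show (0 : Fin 3) ≠ 1 by decide)
        (show (0 : Fin 3) ≠ 2 by decide) (show (1 : Fin 3) ≠ 2 by decide) k
      all_goals omega
  have s0 := hsn 0
  have s1 := hsn 1
  have s2 := hsn 2
  have := H.exists_edge hℓ hm hnt hmin
    (fun i r hr => hyq i r hr hyx) (fun i r hr h => ?_) (fun i => ?_) (fun i k hik => ?_)
    (fun i k hik => ?_) ?_ hdet
  · obtain ⟨i, t, htc, h1, h2, h3⟩ := this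
    refine ⟨q i t, q i (t + 1), ?_, ?_, H.ne i _ _ (Nat.lt_succ_self _) htc, h1, h2,
      (H.adj i _ _ (Nat.lt_succ_self _) htc).2 rfl, ?_⟩
    · refine (qA i t (by omega)).resolve_left fun h => ?_
      rw [h] at h1
      exact D.nadj h1.symm
    · refine (qA i _ htc).resolve_left fun h => ?_
      rw [h] at h2
      exact D.nadj h2.symm
    · rintro _ ⟨j, r, hr, hrx, rfl⟩ h
      have hrs : r ≤ s j := by
        by_contra hlt
        exact hrx (s j) (by omega) (hs j)
      rw [← q1 j r hrs] at h ⊢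
      exact h3 j r (by simp only [hc]; omega) h
  · have := hya i r hr h
    simp only [hc]
    omega
  · have := hsn i
    simp only [hc]
    omega
  · have := hsn i
    have := hsn k
    simp only [hc]
    omega
  · have := hsn i
    have := hsn k
    obtain ⟨h, hih, hkh⟩ := exists_third hik
    have := sum_three_eq n hik hih hkh
    simp only [hc]
    omega
  · obtain ⟨_, ⟨j, r, hr, hrx, rfl⟩, h⟩ := hyA
    have hrs : r ≤ s j := by
      by_contra hlt
      exact hrx (s j) (by omega) (hs j)
    exact ⟨j, r, by simp only [hc]; omega, by rwa [q1 j r hrs]⟩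

end IndexedPrism

end LEH

namespace LEH

variable {V : Type*} {G : SimpleGraph V} {ℓ m : ℕ} {p : Fin 3 → ℕ → V} {n : Fin 3 → ℕ} {x y : V}
  {j k h : Fin 3} {s g u d : ℕ}

/-- The vertex `x` has first and last neighbours `p j s` and `p j g` on the `j`-th path, first
neighbour `p k u` on the `k`-th path, and no neighbour on the `h`-th path. -/
structure Skips (G : SimpleGraph V) (p : Fin 3 → ℕ → V) (n : Fin 3 → ℕ) (x : V) (j k h : Fin 3)
    (s g u : ℕ) : Prop where
  jk : j ≠ k
  jh : j ≠ h
  kh : k ≠ h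
  sg : s ≤ g
  gn : g ≤ n j
  adj_s : G.Adj x (p j s)
  adj_g : G.Adj x (p j g)
  bound : ∀ r ≤ n j, G.Adj x (p j r) → s ≤ r ∧ r ≤ g
  un : u ≤ n k
  adj_u : G.Adj x (p k u)
  first : ∀ r < u, ¬ G.Adj x (p k r)
  nadj : ∀ r ≤ n h, ¬ G.Adj x (p h r)

/-- The first path of the pyramid: along the `j`-th path to `p j s`, then possibly `x`. -/
def skipLeft (p : Fin 3 → ℕ → V) (x : V) (j : Fin 3) (s r : ℕ) : V :=
  if r ≤ s then p j r else x

/-- The second path of the pyramid: along the `k`-th path to `p k u`, then `x`, and possibly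
`p j s`. -/
def skipMid (p : Fin 3 → ℕ → V) (x : V) (j k : Fin 3) (s u r : ℕ) : V :=
  if r ≤ u then p k r else if r = u + 1 then x else p j s

/-- The third path of the pyramid: along the whole `h`-th path, back along the `j`-th path to
`p j g`, and then possibly `x`. -/
def skipRight (p : Fin 3 → ℕ → V) (n : Fin 3 → ℕ) (x : V) (j h : Fin 3) (g r : ℕ) : V :=
  if r ≤ n h then p h r else if r ≤ n h + 1 + (n j - g) then p j (n h + 1 + n j - r) else x

theorem skipLeft_of_le {r : ℕ} (hr : r ≤ s) : skipLeft p x j s r = p j r := if_pos hr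

theorem skipLeft_succ : skipLeft p x j s (s + 1) = x := if_neg (by omega)

theorem skipMid_of_le {r : ℕ} (hr : r ≤ u) : skipMid p x j k s u r = p k r := if_pos hr

theorem skipMid_succ : skipMid p x j k s u (u + 1) = x := by simp [skipMid]

theorem skipMid_succ_succ : skipMid p x j k s u (u + 2) = p j s := by simp [skipMid]

theorem skipRight_of_le {r : ℕ} (hr : r ≤ n h) : skipRight p n x j h g r = p h r := if_pos hr

theorem skipRight_of_lt {r : ℕ} (hr : n h < r) (hr' : r ≤ n h + 1 + (n j - g)) :
    skipRight p n x j h g r = p j (n h + 1 + n j - r) := by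
  rw [skipRight, if_neg (by omega), if_pos hr']

theorem skipRight_succ : skipRight p n x j h g (n h + 1 + (n j - g) + 1) = x := by
  rw [skipRight, if_neg (by omega), if_neg (by omega)]

namespace Skips

/-- The index at which the pyramid's apex is chosen: `x` if `d = 1`, and `p j s` if `d = 0`. -/
def apex (p : Fin 3 → ℕ → V) (x : V) (j : Fin 3) (s d : ℕ) : V := if d = 1 then x else p j s

theorem adj_left (S : Skips G p n x j k h s g u) {r : ℕ} (hr : r ≤ s) :
    G.Adj x (p j r) ↔ r = s := by
  refine ⟨fun h => ?_, fun h => h ▸ S.adj_s⟩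
  have := S.bound r (hr.trans (S.sg.trans S.gn)) h
  omega

theorem adj_mid (S : Skips G p n x j k h s g u) {r : ℕ} (hr : r ≤ u) :
    G.Adj x (p k r) ↔ r = u := by
  refine ⟨fun h => ?_, fun h => h ▸ S.adj_u⟩
  by_contra hne
  exact S.first r (by omega) h

theorem adj_right (S : Skips G p n x j k h s g u) {r : ℕ} (hr : g ≤ r) (hrn : r ≤ n j) :
    G.Adj x (p j r) ↔ r = g := by
  refine ⟨fun h => ?_, fun h => h ▸ S.adj_g⟩
  have := S.bound r hrn h
  omega

theorem pathTo_left (S : Skips G p n x j k h s g u) (K : IndexedPrism G ℓ p n)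
    (X : Spread G ℓ m p n x) (hd : d = 1 ∨ d = 0) :
    PathTo G (skipLeft p x j s) (s + d) (apex p x j s d) := by
  have := S.sg.trans S.gn
  refine ⟨?_, fun r t hrt ht => ?_, fun r t hrt ht => ?_⟩
  · rcases hd with rfl | rfl
    · exact skipLeft_succ
    · exact skipLeft_of_le le_rfl
  all_goals
    rw [skipLeft_of_le (by omega : r ≤ s)]
    obtain h | rfl : t ≤ s ∨ t = s + 1 := by omega
  · rw [skipLeft_of_le h]
    exact K.ne j r t hrt (by omega)
  · rw [skipLeft_succ]
    exact (X.ne j r (by omega)).symm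
  · rw [skipLeft_of_le h]
    exact K.adj j r t hrt (by omega)
  · rw [skipLeft_succ, G.adj_comm, S.adj_left (by omega)]
    omega

theorem pathTo_mid (S : Skips G p n x j k h s g u) (K : IndexedPrism G ℓ p n)
    (X : Spread G ℓ m p n x) (hm : 2 ≤ m) (hd : d = 1 ∨ d = 0) :
    PathTo G (skipMid p x j k s u) (u + 2 - d) (apex p x j s d) := by
  have b1 := X.mid k u S.un S.adj_u
  have b2 := X.mid j s (S.sg.trans S.gn) S.adj_s
  refine ⟨?_, fun r t hrt ht => ?_, fun r t hrt ht => ?_⟩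
  · rcases hd with rfl | rfl
    · exact skipMid_succ
    · exact skipMid_succ_succ
  all_goals
    obtain h' | rfl : r ≤ u ∨ r = u + 1 := by omega
    · rw [skipMid_of_le h']
      obtain h | rfl | rfl : t ≤ u ∨ t = u + 1 ∨ t = u + 2 := by omega
      · rw [skipMid_of_le h]
        first
        | exact K.ne k r t hrt (by omega)
        | exact K.adj k r t hrt (by omega)
      · rw [skipMid_succ]
        first
        | exact (X.ne k r (by omega)).symm
        | rw [G.adj_comm, S.adj_mid (by omega)]
          omega
      · rw [skipMid_succ_succ]
        first
        | exact (K.cross k j _ _ S.jk.symm (by omega) (by omega)).1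
        | rw [K.adj_cross S.jk.symm (by omega) (by omega)]
          omega
    · obtain rfl : t = u + 2 := by omega
      rw [skipMid_succ, skipMid_succ_succ]
      first
      | exact X.ne j s (by omega)
      | exact iff_of_true S.adj_s rfl

theorem pathTo_right (S : Skips G p n x j k h s g u) (K : IndexedPrism G ℓ p n)
    (X : Spread G ℓ m p n x) (hm : 2 ≤ m) (hd : d = 1 ∨ d = 0 ∧ s = g) :
    PathTo G (skipRight p n x j h g) (n h + 1 + (n j - g) + d) (apex p x j s d) := by
  have b1 := X.mid j g S.gn S.adj_g
  refine ⟨?_, fun r t hrt ht => ?_, fun r t hrt ht => ?_⟩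
  · rcases hd with rfl | ⟨rfl, rfl⟩
    · exact skipRight_succ
    · rw [skipRight_of_lt (by omega) (by omega)]
      congr 1
      omega
  all_goals
    obtain h' | h' : r ≤ n h ∨ n h < r := by omega
    · rw [skipRight_of_le h']
      obtain ht' | ⟨ht', ht''⟩ | rfl : t ≤ n h ∨ (n h < t ∧ t ≤ n h + 1 + (n j - g)) ∨
          t = n h + 1 + (n j - g) + 1 := by omega
      · rw [skipRight_of_le ht']
        first
        | exact K.ne h r t hrt (by omega)
        | exact K.adj h r t hrt (by omega)
      · rw [skipRight_of_lt ht' ht'']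
        first
        | exact (K.cross h j _ _ S.jh.symm (by omega) (by omega)).1
        | rw [K.adj_cross S.jh.symm (by omega) (by omega)]
          omega
      · rw [skipRight_succ]
        first
        | exact (X.ne h r (by omega)).symm
        | rw [G.adj_comm]
          exact iff_of_false (S.nadj r h') (by omega)
    · rw [skipRight_of_lt h' (by omega)]
      obtain ht'' | rfl : t ≤ n h + 1 + (n j - g) ∨ t = n h + 1 + (n j - g) + 1 := by omega
      · rw [skipRight_of_lt (by omega) ht'']
        first
        | rw [ne_eq, K.eq_same (by omega) (by omega)]
          omega
        | rw [K.adj_same (by omega) (by omega)]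
          omega
      · rw [skipRight_succ]
        first
        | exact (X.ne j _ (by omega)).symm
        | rw [G.adj_comm, S.adj_right (by omega) (by omega)]
          omega

theorem pyramid (S : Skips G p n x j k h s g u) (K : IndexedPrism G ℓ p n)
    (X : Spread G ℓ m p n x) (hm : 2 ≤ m) (hd : d = 1 ∧ s + 2 ≤ g ∨ d = 0 ∧ s = g) :
    Pyramid G ![skipLeft p x j s, skipMid p x j k s u, skipRight p n x j h g]
      ![s + d, u + 2 - d, n h + 1 + (n j - g) + d] (apex p x j s d) := by
  have b1 := X.mid k u S.un S.adj_u
  have b2 := X.mid j s (S.sg.trans S.gn) S.adj_s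
  have b3 := X.mid j g S.gn S.adj_g
  have b4 := S.gn
  refine Pyramid.of_three (S.pathTo_left K X (by omega)) (S.pathTo_mid K X hm (by omega))
    (S.pathTo_right K X hm (by omega)) (fun r t hr ht => ?_) (fun r t hr ht => ?_)
    (fun r t hr ht => ?_)
  · rw [skipLeft_of_le (by omega)]
    obtain ht' | rfl : t ≤ u ∨ t = u + 1 := by omega
    · rw [skipMid_of_le ht', K.adj_cross S.jk (by omega) (by omega)]
      exact ⟨(K.cross j k r t S.jk (by omega) (by omega)).1, by omega⟩
    · rw [skipMid_succ, G.adj_comm, S.adj_left (by omega)]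
      exact ⟨(X.ne j r (by omega)).symm, by omega⟩
  · rw [skipLeft_of_le (by omega)]
    obtain ht' | ht' : t ≤ n h ∨ n h < t := by omega
    · rw [skipRight_of_le ht', K.adj_cross S.jh (by omega) (by omega)]
      exact ⟨(K.cross j h r t S.jh (by omega) (by omega)).1, by omega⟩
    · rw [skipRight_of_lt ht' (by omega), ne_eq, K.eq_same (by omega) (by omega),
        K.adj_same (by omega) (by omega)]
      omega
  · obtain hr' | rfl : r ≤ u ∨ r = u + 1 := by omega
    · rw [skipMid_of_le hr']
      obtain ht' | ht' : t ≤ n h ∨ n h < t := by omega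
      · rw [skipRight_of_le ht', K.adj_cross S.kh (by omega) (by omega)]
        exact ⟨(K.cross k h r t S.kh (by omega) (by omega)).1, by omega⟩
      · rw [skipRight_of_lt ht' (by omega), K.adj_cross S.jk.symm (by omega) (by omega)]
        exact ⟨(K.cross k j _ _ S.jk.symm (by omega) (by omega)).1, by omega⟩
    · rw [skipMid_succ]
      obtain ht' | ht' : t ≤ n h ∨ n h < t := by omega
      · rw [skipRight_of_le ht']
        exact ⟨X.ne h t ht', iff_of_false (S.nadj t ht') (by omega)⟩
      · rw [skipRight_of_lt ht' (by omega), S.adj_right (by omega) (by omega)]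
        exact ⟨X.ne j _ (by omega), by omega⟩

end Skips

end LEH

namespace LEH

variable {V : Type*} {G : SimpleGraph V} {ℓ m : ℕ} {p : Fin 3 → ℕ → V} {n : Fin 3 → ℕ} {x y : V}
  {j k h : Fin 3} {s g u d : ℕ}

namespace Skips

/-- The vertex `y` has no neighbour close to `p j s` or `p k u`, nor just after `p j g`. -/
structure Clear (G : SimpleGraph V) (m : ℕ) (p : Fin 3 → ℕ → V) (n : Fin 3 → ℕ) (x y : V)
    (j k : Fin 3) (s g u : ℕ) : Prop where
  nadj : ¬ G.Adj x y
  left : ∀ r ≤ n j, s ≤ r + 2 * m → r ≤ s + 1 → ¬ G.Adj y (p j r)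
  mid : ∀ r ≤ n k, u ≤ r + 2 * m → r ≤ u + 1 → ¬ G.Adj y (p k r)
  right : ∀ r ≤ n j, g ≤ r → r < g + 2 * m → ¬ G.Adj y (p j r)

theorem adj_cases (S : Skips G p n x j k h s g u) (Y : Spread G ℓ m p n y)
    (C : Clear G m p n x y j k s g u) (hd : d = 1 ∨ d = 0) {i : Fin 3} {r : ℕ}
    (hr : r ≤ (![s + d, u + 2 - d, n h + 1 + (n j - g) + d] : Fin 3 → ℕ) i)
    (ha : G.Adj y ((![skipLeft p x j s, skipMid p x j k s u, skipRight p n x j h g] :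
      Fin 3 → ℕ → V) i r)) :
    m ≤ r ∧ (i = 0 ∧ r + 2 * m + 1 ≤ s ∨ i = 1 ∧ r + 2 * m + 1 ≤ u ∨ i = 2 ∧ r + m ≤ n h ∨
      i = 2 ∧ n h < r ∧ r + 2 * m ≤ n h + 1 + (n j - g)) := by
  have b1 := S.un
  have b2 := S.gn
  have b3 := S.sg
  fin_cases i <;> simp only [Fin.zero_eta, Fin.mk_one, Fin.reduceFinMk, Matrix.cons_val_zero,
    Matrix.cons_val_one, Matrix.cons_val, Fin.reduceEq, Fin.isValue, true_and, false_and,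
    false_or, or_false, zero_ne_one, one_ne_zero] at hr ha ⊢
  · obtain hr' | rfl : r ≤ s ∨ r = s + 1 := by omega
    · rw [skipLeft_of_le hr'] at ha
      have := Y.mid j r (by omega) ha
      have := C.left r (by omega)
      by_contra hne
      exact this (by omega) (by omega) ha
    · rw [skipLeft_succ] at ha
      exact (C.nadj ha.symm).elim
  · obtain hr' | rfl | rfl : r ≤ u ∨ r = u + 1 ∨ r = u + 2 := by omega
    · rw [skipMid_of_le hr'] at ha
      have := Y.mid k r (by omega) ha
      have := C.mid r (by omega)
      by_contra hne
      exact this (by omega) (by omega) ha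
    · rw [skipMid_succ] at ha
      exact (C.nadj ha.symm).elim
    · rw [skipMid_succ_succ] at ha
      exact (C.left s (by omega) (by omega) (by omega) ha).elim
  · obtain hr' | ⟨h1, h2⟩ | rfl : r ≤ n h ∨ (n h < r ∧ r ≤ n h + 1 + (n j - g)) ∨
        r = n h + 1 + (n j - g) + 1 := by omega
    · rw [skipRight_of_le hr'] at ha
      have := Y.mid h r hr' ha
      omega
    · rw [skipRight_of_lt h1 h2] at ha
      have := Y.mid j _ (by omega) ha
      have := C.right _ (by omega) (by omega) |>.mt (not_not.2 ha)
      omega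
    · rw [skipRight_succ] at ha
      exact (C.nadj ha.symm).elim

theorem eq_cases (S : Skips G p n x j k h s g u) (hd : d = 1 ∨ d = 0) {i : Fin 3} {r : ℕ}
    (hr : r ≤ (![s + d, u + 2 - d, n h + 1 + (n j - g) + d] : Fin 3 → ℕ) i) {z : V}
    (hz : z = (![skipLeft p x j s, skipMid p x j k s u, skipRight p n x j h g] :
      Fin 3 → ℕ → V) i r) :
    z = x ∨ (∃ t ≤ s, z = p j t) ∨ (∃ t ≤ u, z = p k t) ∨ (∃ t ≤ n h, z = p h t) ∨
      ∃ t, g ≤ t ∧ t ≤ n j ∧ z = p j t := by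
  have := S.gn
  fin_cases i <;> simp only [Fin.zero_eta, Fin.mk_one, Fin.reduceFinMk, Matrix.cons_val_zero,
    Matrix.cons_val_one, Matrix.cons_val] at hr hz
  · obtain hr' | rfl : r ≤ s ∨ r = s + 1 := by omega
    · exact .inr (.inl ⟨r, hr', hz.trans (skipLeft_of_le hr')⟩)
    · exact .inl (hz.trans skipLeft_succ)
  · obtain hr' | rfl | rfl : r ≤ u ∨ r = u + 1 ∨ r = u + 2 := by omega
    · exact .inr (.inr (.inl ⟨r, hr', hz.trans (skipMid_of_le hr')⟩))
    · exact .inl (hz.trans skipMid_succ)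
    · exact .inr (.inl ⟨s, le_rfl, hz.trans skipMid_succ_succ⟩)
  · obtain hr' | ⟨h1, h2⟩ | rfl : r ≤ n h ∨ (n h < r ∧ r ≤ n h + 1 + (n j - g)) ∨
        r = n h + 1 + (n j - g) + 1 := by omega
    · exact .inr (.inr (.inr (.inl ⟨r, hr', hz.trans (skipRight_of_le hr')⟩)))
    · exact .inr (.inr (.inr (.inr
        ⟨_, by omega, by omega, hz.trans (skipRight_of_lt h1 h2)⟩)))
    · exact .inl (hz.trans skipRight_succ)

theorem detour_mid (S : Skips G p n x j k h s g u) (K : IndexedPrism G ℓ p n)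
    (X : Spread G ℓ m p n x) (Y : Spread G ℓ m p n y)
    (hℓ : ℓ = 2 * m + 2) (hm : 2 ≤ m) (hd : d = 1 ∧ s + 2 ≤ g ∨ d = 0 ∧ s = g) {i : Fin 3}
    (hi : i ≠ 1) (hk : ∃ r ≤ n k, G.Adj y (p k r)) (hu : ∀ r ≤ u, ¬ G.Adj y (p k r)) :
    Detour G ![skipLeft p x j s, skipMid p x j k s u, skipRight p n x j h g]
      ![s + d, u + 2 - d, n h + 1 + (n j - g) + d] y m (n 0 + n 1 + n 2 + 3 + ℓ) i := by
  obtain ⟨t, htn, ht⟩ := hk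
  have b1 := X.mid k u S.un S.adj_u
  have b2 := X.mid j s (S.sg.trans S.gn) S.adj_s
  have b3 := X.mid j g S.gn S.adj_g
  have b4 := Y.mid k t htn ht
  have b5 : u < t := by
    by_contra hlt
    exact hu t (by omega) ht
  refine Detour.of_path (f := fun r => p k (u + r)) (L := n k - m - u) (t := u) (x := x)
    hi ?_ ?_ ?_ ?_ (by omega) ?_ (skipMid_of_le le_rfl) skipMid_succ ?_ ?_
  · intro r r' h1 h2
    exact K.ne k _ _ (by omega) (by omega)
  · intro r r' h1 h2
    rw [K.adj k _ _ (by omega) (by omega)]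
    omega
  · intro r hr
    exact Y.ne k _ (by omega)
  · exact ⟨t - u, by omega, by omega, by rwa [Nat.add_sub_cancel' b5.le]⟩
  · simp only [Matrix.cons_val_one, Matrix.cons_val_zero]
    omega
  · intro r h1 h2 j' t hj'
    generalize hz : (![skipLeft p x j s, skipMid p x j k s u, skipRight p n x j h g] :
      Fin 3 → ℕ → V) j' t = z
    rcases S.eq_cases (by omega) hj' hz.symm with rfl | ⟨t, ht, rfl⟩ | ⟨t, ht, rfl⟩ |
      ⟨t, ht, rfl⟩ | ⟨t, ht, ht', rfl⟩
    · exact ⟨(X.ne k _ (by omega)).symm, fun _ => .inl rfl⟩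
    · rw [K.ne_and_imp_iff S.jk.symm (by omega) (by omega)]
      omega
    · rw [ne_eq, K.eq_same (by omega) (by omega), K.adj_same (by omega) (by omega)]
      refine ⟨by omega, fun h => .inr ⟨?_, by omega⟩⟩
      congr 1
      omega
    · rw [K.ne_and_imp_iff S.kh (by omega) (by omega)]
      omega
    · rw [K.ne_and_imp_iff S.jk.symm (by omega) (by omega)]
      omega
  · have := sum_three_eq n S.jk S.jh S.kh
    simp only [Matrix.cons_val_one, Matrix.cons_val_zero, Matrix.cons_val]
    omega

theorem detour_left (S : Skips G p n x j k h s g u) (K : IndexedPrism G ℓ p n)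
    (X : Spread G ℓ m p n x) (Y : Spread G ℓ m p n y) (C : Clear G m p n x y j k s g u)
    (hℓ : ℓ = 2 * m + 2) (hm : 2 ≤ m) (hd : d = 1 ∧ s + 2 ≤ g ∨ d = 0 ∧ s = g) {i : Fin 3}
    (hi : i ≠ 2) (hk : ∃ r ≤ n j, G.Adj y (p j r)) (hs : ∀ r ≤ s, ¬ G.Adj y (p j r))
    (hg : ∀ r ≤ n j, g ≤ r → ¬ G.Adj y (p j r)) :
    Detour G ![skipLeft p x j s, skipMid p x j k s u, skipRight p n x j h g]
      ![s + d, u + 2 - d, n h + 1 + (n j - g) + d] y m (n 0 + n 1 + n 2 + 3 + ℓ) i := by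
  obtain ⟨t, htn, ht⟩ := hk
  have b1 := X.mid k u S.un S.adj_u
  have b2 := X.mid j s (S.sg.trans S.gn) S.adj_s
  have b3 := X.mid j g S.gn S.adj_g
  have b4 := Y.mid j t htn ht
  have b0 := S.sg
  have b00 := S.gn
  have b5 : s + 2 ≤ t := by
    by_contra hlt
    obtain h | rfl : t ≤ s ∨ t = s + 1 := by omega
    · exact hs t h ht
    · exact C.left _ htn (by omega) le_rfl ht
  have b6 : t < g := by
    by_contra hlt
    exact hg t htn (by omega) ht
  obtain ⟨rfl, hsg⟩ : d = 1 ∧ s + 2 ≤ g := by omega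
  refine Detour.of_path (f := fun r => p j (g - r)) (L := g - s - 2) (t := n h + 1 + (n j - g))
    (x := x) hi ?_ ?_ ?_ ?_ (by omega) (Nat.lt_succ_self _) ?_ skipRight_succ ?_ ?_
  · intro r r' h1 h2
    exact (K.ne j _ _ (by omega) (by omega)).symm
  · intro r r' h1 h2
    rw [G.adj_comm, K.adj j _ _ (by omega) (by omega)]
    omega
  · intro r hr
    exact Y.ne j _ (by omega)
  · exact ⟨g - t, by omega, by omega, by rwa [Nat.sub_sub_self b6.le]⟩
  · refine (skipRight_of_lt (by omega) le_rfl).trans ?_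
    congr 1
    omega
  · intro r h1 h2 j' t hj'
    generalize hz : (![skipLeft p x j s, skipMid p x j k s u, skipRight p n x j h g] :
      Fin 3 → ℕ → V) j' t = z
    rcases S.eq_cases (.inl rfl) hj' hz.symm with rfl | ⟨t, ht, rfl⟩ | ⟨t, ht, rfl⟩ |
      ⟨t, ht, rfl⟩ | ⟨t, ht, ht', rfl⟩
    · exact ⟨(X.ne j _ (by omega)).symm, fun _ => .inl rfl⟩
    · rw [ne_eq, K.eq_same (by omega) (by omega), K.adj_same (by omega) (by omega)]
      omega
    · rw [K.ne_and_imp_iff S.jk (by omega) (by omega)]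
      omega
    · rw [K.ne_and_imp_iff S.jh (by omega) (by omega)]
      omega
    · rw [ne_eq, K.eq_same (by omega) (by omega), K.adj_same (by omega) (by omega)]
      refine ⟨by omega, fun h => .inr ⟨?_, by omega⟩⟩
      congr 1
      omega
  · have := sum_three_eq n S.jk S.jh S.kh
    simp only [Matrix.cons_val_one, Matrix.cons_val_zero, Matrix.cons_val]
    omega

theorem exists_edge (S : Skips G p n x j k h s g u) (K : IndexedPrism G ℓ p n)
    (X : Spread G ℓ m p n x) (Y : Spread G ℓ m p n y) (C : Clear G m p n x y j k s g u)
    (hℓ : ℓ = 2 * m + 2) (hm : 2 ≤ m) (hnt : ¬ HasLongTheta G ℓ)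
    (hmin : ∀ N, HasPrism G ℓ N → n 0 + n 1 + n 2 + 3 ≤ N)
    (hyA : ∃ z ∈ UpToFirst G p n x, G.Adj y z) (hk : ∃ r ≤ n k, G.Adj y (p k r)) :
    ∃ z₁ z₂, z₁ ∈ UpToFirst G p n x ∧ z₂ ∈ UpToFirst G p n x ∧ z₁ ≠ z₂ ∧
      G.Adj y z₁ ∧ G.Adj y z₂ ∧ G.Adj z₁ z₂ ∧
      ∀ z ∈ UpToFirst G p n x, G.Adj y z → z = z₁ ∨ z = z₂ := by
  obtain ⟨d, hd⟩ : ∃ d, d = 1 ∧ s + 2 ≤ g ∨ d = 0 ∧ s = g := by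
    rcases S.sg.eq_or_lt with h | h
    · exact ⟨0, .inr ⟨rfl, h⟩⟩
    · refine ⟨1, .inl ⟨rfl, ?_⟩⟩
      by_contra hlt
      obtain rfl : g = s + 1 := by omega
      exact K.last_nbr_ne_succ X hℓ hm hmin S.jk S.jh S.kh S.gn S.adj_s S.adj_g S.bound S.un
        S.adj_u (fun r hr hxr => not_lt.1 fun hlt => S.first r hlt hxr) S.nadj
  have H := S.pyramid K X hm hd
  have b1 := X.mid k u S.un S.adj_u
  have b2 := X.mid j s (S.sg.trans S.gn) S.adj_s
  have b3 := X.mid j g S.gn S.adj_g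
  have b0 := S.sg
  have b00 := S.gn
  have hsum := sum_three_eq n S.jk S.jh S.kh
  have hd' : d = 1 ∨ d = 0 := by omega
  have hyx : y ≠ x := by
    rintro rfl
    exact C.left s (by omega) (by omega) (by omega) S.adj_s
  have yx : ∀ {z}, G.Adj y z → z ≠ x := by
    rintro z hz rfl
    exact C.nadj hz.symm
  have hA : ∀ z ∈ UpToFirst G p n x, ∃ i r,
      r ≤ (![s + d, u + 2 - d, n h + 1 + (n j - g) + d] : Fin 3 → ℕ) i ∧
      z = (![skipLeft p x j s, skipMid p x j k s u, skipRight p n x j h g] :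
      Fin 3 → ℕ → V) i r := by
    rintro _ ⟨i, r, hr, hxr, rfl⟩
    obtain rfl | rfl | rfl := eq_or_eq_or_eq S.jk S.jh S.kh i
    · have : r ≤ s := by
        by_contra hlt
        exact hxr s (by omega) S.adj_s
      exact ⟨0, r, Nat.le_add_right_of_le this, (skipLeft_of_le this).symm⟩
    · have : r ≤ u := by
        by_contra hlt
        exact hxr u (by omega) S.adj_u
      exact ⟨1, r, show r ≤ u + 2 - d by omega, (skipMid_of_le this).symm⟩
    · exact ⟨2, r, show r ≤ n i + 1 + (n j - g) + d by omega, (skipRight_of_le hr).symm⟩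
  have hB : ∀ z, z ≠ x → (∃ t ≤ s, z = p j t) ∨ (∃ t ≤ u, z = p k t) ∨ (∃ t ≤ n h, z = p h t) →
      z ∈ UpToFirst G p n x := by
    rintro z hzx (⟨t, ht, rfl⟩ | ⟨t, ht, rfl⟩ | ⟨t, ht, rfl⟩)
    · refine ⟨j, t, by omega, fun r hr hxr => ?_, rfl⟩
      have := (S.bound r (by omega) hxr).1
      omega
    · exact ⟨k, t, by omega, fun r hr => S.first r (by omega), rfl⟩
    · exact ⟨h, t, ht, fun r hr => S.nadj r (by omega), rfl⟩
  have hC : ∀ z ∈ UpToFirst G p n x, G.Adj y z → ∀ r, g ≤ r → r ≤ n j → z ≠ p j r := by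
    rintro _ ⟨i, t, ht, hxt, rfl⟩ hy r hgr hrn hz
    by_cases hij : i = j
    · subst hij
      rw [K.eq_same ht hrn] at hz
      have : t ≤ s := by
        by_contra hlt
        exact hxt s (by omega) S.adj_s
      exact C.left t ht (by omega) (by omega) hy
    · exact (K.cross i j t r hij ht hrn).1 hz
  have := H.exists_edge hℓ hm hnt hmin (y := y)
    (fun i r hr => ?_) (fun i r hr ha => ?_) (fun i => ?_) (fun i i' hii => ?_)
    (fun i i' hii => ?_) ?_ (fun i hi => ?_)
  · obtain ⟨i, t, htc, h1, h2, h3⟩ := this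
    have h3' := fun z (hz : z ∈ UpToFirst G p n x) (hyz : G.Adj y z) => show z = _ ∨ z = _ by
      obtain ⟨i, r, hr, rfl⟩ := hA z hz
      exact h3 i r hr hyz
    refine ⟨_, _, ?_, ?_, H.ne i t (t + 1) (Nat.lt_succ_self _) htc, h1, h2,
      (H.adj i t (t + 1) (Nat.lt_succ_self _) htc).2 rfl, h3'⟩
    all_goals
      have c1 := S.adj_cases Y C hd' (by omega) h1
      have c2 := S.adj_cases Y C hd' htc h2
      refine hB _ (yx ‹_›) ?_
      fin_cases i <;> simp only [Fin.zero_eta, Fin.mk_one, Fin.reduceFinMk, Matrix.cons_val_zero,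
        Matrix.cons_val_one, Matrix.cons_val, Fin.reduceEq, Fin.isValue, true_and, false_and,
        false_or, or_false, zero_ne_one, one_ne_zero] at htc c1 c2 ⊢
      · exact .inl ⟨_, by omega, skipLeft_of_le (by omega)⟩
      · exact .inr (.inl ⟨_, by omega, skipMid_of_le (by omega)⟩)
      · refine .inr (.inr ⟨_, ?_, skipRight_of_le ?_⟩) <;>
        · by_contra hlt
          obtain ⟨z, hz, hyz⟩ := hyA
          rcases h3' z hz hyz with h | h
          · exact hC z hz hyz _ (by omega) (by omega)
              (h.trans (skipRight_of_lt (by omega) (by omega)))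
          · exact hC z hz hyz _ (by omega) (by omega)
              (h.trans (skipRight_of_lt (by omega) (by omega)))
  · intro hyz
    rcases S.eq_cases hd' hr hyz with h | ⟨t, ht, h⟩ | ⟨t, ht, h⟩ | ⟨t, ht, h⟩ | ⟨t, ht, ht', h⟩
    · exact hyx h
    · exact Y.ne j t (by omega) h
    · exact Y.ne k t (by omega) h
    · exact Y.ne _ t ht h
    · exact Y.ne j t ht' h
  · have := S.adj_cases Y C hd' hr ha
    fin_cases i <;> simp only [Fin.zero_eta, Fin.mk_one, Fin.reduceFinMk, Matrix.cons_val_zero,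
      Matrix.cons_val_one, Matrix.cons_val, Fin.reduceEq, Fin.isValue, true_and, false_and,
      false_or, or_false, zero_ne_one, one_ne_zero] at this ⊢ <;> omega
  · fin_cases i <;> simp only [Fin.zero_eta, Fin.mk_one, Fin.reduceFinMk, Matrix.cons_val_zero,
      Matrix.cons_val_one, Matrix.cons_val] <;> omega
  · fin_cases i <;> fin_cases i' <;> first | exact (hii rfl).elim | skip
    all_goals
      simp only [Fin.zero_eta, Fin.mk_one, Fin.reduceFinMk, Matrix.cons_val_zero,
        Matrix.cons_val_one, Matrix.cons_val]
      omega
  · fin_cases i <;> fin_cases i' <;> first | exact (hii rfl).elim | skip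
    all_goals
      simp only [Fin.zero_eta, Fin.mk_one, Fin.reduceFinMk, Matrix.cons_val_zero,
        Matrix.cons_val_one, Matrix.cons_val]
      omega
  · obtain ⟨z, hz, hyz⟩ := hyA
    obtain ⟨i, r, hr, rfl⟩ := hA z hz
    exact ⟨i, r, hr, hyz⟩
  · by_cases hi1 : i = 1
    · subst hi1
      have hj : ∀ r ≤ s, ¬ G.Adj y (p j r) := fun r hr hyr =>
        hi 0 (by decide) r (Nat.le_add_right_of_le hr)
          ((congrArg (G.Adj y) (skipLeft_of_le hr)).mpr hyr)
      have hh : ∀ r ≤ n h, ¬ G.Adj y (p h r) := fun r hr hyr =>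
        hi 2 (by decide) r (show r ≤ n h + 1 + (n j - g) + d by omega)
          ((congrArg (G.Adj y) (skipRight_of_le hr)).mpr hyr)
      have hg : ∀ r ≤ n j, g ≤ r → ¬ G.Adj y (p j r) := fun r hr hgr hyr => by
        refine hi 2 (by decide) (n h + 1 + n j - r)
          (show n h + 1 + n j - r ≤ n h + 1 + (n j - g) + d by omega) ?_
        have : p j r = p j (n h + 1 + n j - (n h + 1 + n j - r)) := by
          congr 1
          omega
        rw [this] at hyr
        exact (congrArg (G.Adj y) (skipRight_of_lt (by omega) (by omega))).mpr hyr
      refine S.detour_left K X Y C hℓ hm hd (by decide) ?_ hj hg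
      obtain ⟨k', hk', r, hr, hyr⟩ := K.exists_nbr_ne Y hℓ hm hmin k
      obtain rfl | rfl | rfl := eq_or_eq_or_eq S.jk S.jh S.kh k'
      · exact ⟨r, hr, hyr⟩
      · exact (hk' rfl).elim
      · exact (hh r hr hyr).elim
    · refine S.detour_mid K X Y hℓ hm hd hi1 hk fun r hr hyr => ?_
      exact hi 1 hi1 r (show r ≤ u + 2 - d by omega)
        ((congrArg (G.Adj y) (skipMid_of_le hr)).mpr hyr)

end Skips

end LEH

namespace LEH

variable {V : Type*} {G : SimpleGraph V} {ℓ m : ℕ} {p : Fin 3 → ℕ → V} {n : Fin 3 → ℕ} {x y : V}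

namespace IndexedPrism

theorem edge_of_skips (K : IndexedPrism G ℓ p n) (X : Spread G ℓ m p n x)
    (Y : Spread G ℓ m p n y) (D : Apart G m p n x y) (hℓ : ℓ = 2 * m + 2) (hm : 2 ≤ m)
    (hnt : ¬ HasLongTheta G ℓ) (hmin : ∀ N, HasPrism G ℓ N → n 0 + n 1 + n 2 + 3 ≤ N)
    (hyA : ∃ z ∈ UpToFirst G p n x, G.Adj y z) {j k h : Fin 3} (hjk : j ≠ k) (hjh : j ≠ h)
    (hkh : k ≠ h) (hxh : ∀ s ≤ n h, ¬ G.Adj x (p h s)) (hyk : ∃ s ≤ n k, G.Adj y (p k s))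
    (hyj : ∀ s ≤ n j, G.Adj x (p j s) → (∀ r, s < r → r ≤ n j → ¬ G.Adj x (p j r)) →
      ∀ r ≤ n j, s ≤ r → r < s + 2 * m → ¬ G.Adj y (p j r)) :
    ∃ z₁ z₂, z₁ ∈ UpToFirst G p n x ∧ z₂ ∈ UpToFirst G p n x ∧ z₁ ≠ z₂ ∧
      G.Adj y z₁ ∧ G.Adj y z₂ ∧ G.Adj z₁ z₂ ∧
      ∀ z ∈ UpToFirst G p n x, G.Adj y z → z = z₁ ∨ z = z₂ := by
  have hxj : ∃ s ≤ n j, G.Adj x (p j s) := by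
    obtain ⟨i, hi, r, hr, hxr⟩ := K.exists_nbr_ne X hℓ hm hmin k
    obtain rfl | rfl | rfl := eq_or_eq_or_eq hjk hjh hkh i
    · exact ⟨r, hr, hxr⟩
    · exact (hi rfl).elim
    · exact (hxh r hr hxr).elim
  have hxk : ∃ s ≤ n k, G.Adj x (p k s) := by
    obtain ⟨i, hi, r, hr, hxr⟩ := K.exists_nbr_ne X hℓ hm hmin j
    obtain rfl | rfl | rfl := eq_or_eq_or_eq hjk hjh hkh i
    · exact (hi rfl).elim
    · exact ⟨r, hr, hxr⟩
    · exact (hxh r hr hxr).elim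
  obtain ⟨s, g, hsg, hgn, hs, hg, hsm⟩ := exists_first_last hxj
  obtain ⟨u, u', hu', hun, hu, -, hum⟩ := exists_first_last hxk
  have hsf : ∀ r < s, ¬ G.Adj x (p j r) := fun r hr hxr => by
    have := hsm r (by omega) hxr
    omega
  have huf : ∀ r < u, ¬ G.Adj x (p k r) := fun r hr hxr => by
    have := hum r (by omega) hxr
    omega
  have S : Skips G p n x j k h s g u :=
    ⟨hjk, hjh, hkh, hsg, hgn, hs, hg, hsm, hu'.trans hun, hu, huf, hxh⟩
  refine S.exists_edge K X Y ⟨D.nadj, D.first j s (hsg.trans hgn) hs hsf,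
    D.first k u (hu'.trans hun) hu huf, hyj g hgn hg fun r hr hrn hxr => ?_⟩ hℓ hm hnt hmin hyA hyk
  have := hsm r hrn hxr
  omega

theorem exists_edge (K : IndexedPrism G ℓ p n) (X : Spread G ℓ m p n x)
    (Y : Spread G ℓ m p n y) (D : Apart G m p n x y) (hℓ : ℓ = 2 * m + 2) (hm : 2 ≤ m)
    (hnt : ¬ HasLongTheta G ℓ) (hmin : ∀ N, HasPrism G ℓ N → n 0 + n 1 + n 2 + 3 ≤ N)
    (hyA : ∃ z ∈ UpToFirst G p n x, G.Adj y z) :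
    ∃ z₁ z₂, z₁ ∈ UpToFirst G p n x ∧ z₂ ∈ UpToFirst G p n x ∧ z₁ ≠ z₂ ∧
      G.Adj y z₁ ∧ G.Adj y z₂ ∧ G.Adj z₁ z₂ ∧
      ∀ z ∈ UpToFirst G p n x, G.Adj y z → z = z₁ ∨ z = z₂ := by
  by_cases hx : ∀ i, ∃ s ≤ n i, G.Adj x (p i s)
  · exact K.edge_of_forall_nbr X Y D hℓ hm hnt hmin hyA hx
  · push Not at hx
    obtain ⟨h, hxh⟩ := hx
    obtain ⟨j, hhj, hj⟩ := D.skip h hxh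
    obtain ⟨k, hhk, hjk⟩ := exists_third hhj
    by_cases hyk : ∃ s ≤ n k, G.Adj y (p k s)
    · exact K.edge_of_skips X Y D hℓ hm hnt hmin hyA hjk hhj.symm hhk.symm hxh hyk hj
    · push Not at hyk
      refine K.edge_of_skips X Y D hℓ hm hnt hmin hyA hjk.symm hhk.symm hhj.symm hxh ?_
        fun _ _ _ _ r hr _ _ => hyk r hr
      obtain ⟨i, hi, r, hr, hyr⟩ := K.exists_nbr_ne Y hℓ hm hmin h
      obtain rfl | rfl | rfl := eq_or_eq_or_eq hjk hhj.symm hhk.symm i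
      · exact ⟨r, hr, hyr⟩
      · exact (hyk r hr hyr).elim
      · exact (hi rfl).elim

end IndexedPrism

end LEH

namespace LEH

variable {V : Type*} {G : SimpleGraph V} {ℓ : ℕ}

theorem IsHole.nbr_eq {w : V} {c : G.Walk w w} (hc : IsHole c) {v z z₁ z₂ : V}
    (hv : v ∈ c.support) (hz : z ∈ c.support) (hz₁ : z₁ ∈ c.support) (hz₂ : z₂ ∈ c.support)
    (h : G.Adj v z) (h₁ : G.Adj v z₁) (h₂ : G.Adj v z₂) (hne : z₁ ≠ z₂) : z = z₁ ∨ z = z₂ := by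
  have key : ∀ t ∈ c.support, G.Adj v t → t ∈ c.toSubgraph.neighborSet v := fun t ht hvt => by
    rw [Subgraph.mem_neighborSet, ← Subgraph.mem_edgeSet, Walk.mem_edges_toSubgraph]
    exact hc.2.2 v hv t ht hvt
  have hcard := hc.1.ncard_neighborSet_toSubgraph_eq_two hv
  have hfin : (c.toSubgraph.neighborSet v).Finite := Set.finite_of_ncard_ne_zero (by omega)
  have : ({z₁, z₂} : Set V) = c.toSubgraph.neighborSet v := by
    refine Set.eq_of_subset_of_ncard_le ?_ (by rw [hcard, Set.ncard_pair hne]) hfin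
    rintro _ (rfl | rfl)
    · exact key _ hz₁ h₁
    · exact key _ hz₂ h₂
  have := this ▸ key z hz h
  simpa using this

namespace IsLongNearPrism

variable {a b : Fin 3 → V} {P : ∀ i, G.Walk (a i) (b i)}

theorem start_ne_end (h : IsLongNearPrism ℓ a b P) {i j : Fin 3} (hij : i ≠ j) (hi : a i = b i) :
    a j ≠ b j := fun hj =>
  (h.1 i j hij).ne (h.2.2.1 ⟨⟨i, rfl⟩, i, hi.symm⟩ ⟨⟨j, rfl⟩, j, hj.symm⟩)

theorem getVert_ne (h : IsLongNearPrism ℓ a b P) {i j : Fin 3} (hij : i ≠ j) (s t : ℕ) :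
    (P i).getVert s ≠ (P j).getVert t := fun he =>
  h.2.2.2.2.1 i j hij _ ((P i).getVert_mem_support s) (he ▸ (P j).getVert_mem_support t)

theorem getVert_eq_iff (h : IsLongNearPrism ℓ a b P) {i : Fin 3} {s t : ℕ}
    (hs : s ≤ (P i).length) (ht : t ≤ (P i).length) :
    (P i).getVert s = (P i).getVert t ↔ s = t :=
  ⟨fun he => (h.2.2.2.1 i).getVert_injOn hs ht he, fun he => he ▸ rfl⟩

theorem nbr_eq (h : IsLongNearPrism ℓ a b P) {i j : Fin 3} (hij : i ≠ j) {s : ℕ}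
    (hs : s ≤ (P i).length) {z : V} (hz : z ∈ (P i).support ∨ z ∈ (P j).support)
    (ha : G.Adj ((P i).getVert s) z) :
    z = (if s = 0 then (P j).getVert 0 else (P i).getVert (s - 1)) ∨
    z = (if s = (P i).length then (P j).getVert (P j).length else (P i).getVert (s + 1)) := by
  obtain ⟨w, c, hc, -, hcS⟩ := h.2.2.2.2.2 i j hij
  have mem : ∀ t, t ∈ c.support ↔ t ∈ (P i).support ∨ t ∈ (P j).support := fun t =>
    Set.ext_iff.1 hcS t
  refine hc.nbr_eq ((mem _).2 (.inl ((P i).getVert_mem_support s))) ((mem _).2 hz)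
    ((mem _).2 ?_) ((mem _).2 ?_) ha ?_ ?_ ?_
  · split_ifs
    · exact .inr (Walk.getVert_mem_support _ _)
    · exact .inl (Walk.getVert_mem_support _ _)
  · split_ifs
    · exact .inr (Walk.getVert_mem_support _ _)
    · exact .inl (Walk.getVert_mem_support _ _)
  · split_ifs with h0
    · subst h0
      simpa using h.1 i j hij
    · have := (P i).adj_getVert_succ (i := s - 1) (by omega)
      rw [Nat.sub_add_cancel (by omega)] at this
      exact this.symm
  · split_ifs with h0
    · subst h0
      simpa using h.2.1 i j hij
    · exact (P i).adj_getVert_succ (by omega)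
  · split_ifs with h1 h2 h2
    · rw [Walk.getVert_zero, Walk.getVert_length]
      refine h.start_ne_end hij ?_
      rw [← (P i).getVert_zero, ← h1, h2, Walk.getVert_length]
    · exact h.getVert_ne hij.symm _ _
    · exact h.getVert_ne hij _ _
    · rw [ne_eq, h.getVert_eq_iff (by omega) (by omega)]
      omega

theorem indexedPrism (h : IsLongNearPrism ℓ a b P)
    (hlong : ∀ i j, i ≠ j → ℓ ≤ (P i).length ∨ ℓ ≤ (P j).length) :
    IndexedPrism G ℓ (fun i => (P i).getVert) (fun i => (P i).length) := by
  refine ⟨fun i s t hst ht => ?_, fun i s t hst ht => ?_, fun i j s t hij hs ht => ?_, hlong⟩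
  · rw [ne_eq, h.getVert_eq_iff (by omega) ht]
    omega
  · obtain ⟨j, hij⟩ := exists_other i
    refine ⟨fun ha => ?_, ?_⟩
    · have := h.nbr_eq hij (by omega) (.inl ((P i).getVert_mem_support t)) ha
      rw [if_neg (by omega : s ≠ (P i).length), h.getVert_eq_iff ht (by omega)] at this
      rcases this with this | this
      · split_ifs at this
        · exact (h.getVert_ne hij _ _ this).elim
        · rw [h.getVert_eq_iff ht (by omega)] at this
          omega
      · exact this.symm
    · rintro rfl
      exact (P i).adj_getVert_succ ht
  · refine ⟨h.getVert_ne hij _ _, fun ha => ?_, ?_⟩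
    · rcases h.nbr_eq hij hs (.inr ((P j).getVert_mem_support t)) ha with this | this <;>
        split_ifs at this with h0
      · exact .inl ⟨h0, (h.getVert_eq_iff ht (by omega)).1 this⟩
      · exact (h.getVert_ne hij _ _ this.symm).elim
      · exact .inr ⟨h0, (h.getVert_eq_iff ht le_rfl).1 this⟩
      · exact (h.getVert_ne hij _ _ this.symm).elim
    · rintro (⟨rfl, rfl⟩ | ⟨rfl, rfl⟩)
      · simpa using h.1 i j hij
      · simpa using h.2.1 i j hij

theorem ncard_prismSupport (h : IsLongNearPrism ℓ a b P) :
    (prismSupport P).ncard = (P 0).length + (P 1).length + (P 2).length + 3 := by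
  classical
  have hv : ∀ i, (vset (P i)).ncard = (P i).length + 1 := fun i => by
    have : vset (P i) = ((P i).support.toFinset : Set V) := by
      ext z
      simp [vset]
    rw [this, Set.ncard_coe_finset, List.toFinset_card_of_nodup (h.2.2.2.1 i).support_nodup,
      Walk.length_support]
  have hd : ∀ i j, i ≠ j → Disjoint (vset (P i)) (vset (P j)) := fun i j hij =>
    Set.disjoint_left.2 (h.2.2.2.2.1 i j hij)
  have hfin : ∀ i, (vset (P i)).Finite := fun i => (P i).support.finite_toSet
  have : prismSupport P = vset (P 0) ∪ vset (P 1) ∪ vset (P 2) := by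
    ext z
    simp [prismSupport, Fin.exists_fin_succ, or_assoc]
  rw [this, Set.ncard_union_eq _ ((hfin 0).union (hfin 1)) (hfin 2),
    Set.ncard_union_eq (hd 0 1 (by decide)) (hfin 0) (hfin 1), hv, hv, hv]
  · omega
  · exact Set.disjoint_union_left.2 ⟨hd 0 2 (by decide), hd 1 2 (by decide)⟩

end IsLongNearPrism

end LEH

namespace LEH

variable {V : Type*} {G : SimpleGraph V} {ℓ : ℕ}

section Walk

variable {u w : V} {P : G.Walk u w}

theorem getD_support {s : ℕ} (hs : s ≤ P.length) (d : V) : P.support.getD s d = P.getVert s := by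
  rw [List.getD_eq_getElem _ _ (by simpa [Nat.lt_succ_iff] using hs),
    Walk.support_getElem_eq_getVert]

theorem mem_take_support {k : ℕ} {z : V} :
    z ∈ P.support.take k ↔ ∃ r < k, r ≤ P.length ∧ z = P.getVert r := by
  rw [List.mem_take_iff_getElem]
  simp only [Walk.support_getElem_eq_getVert, Walk.length_support, lt_min_iff, Nat.lt_succ_iff]
  exact ⟨fun ⟨r, h, hz⟩ => ⟨r, h.1, h.2, hz.symm⟩, fun ⟨r, h1, h2, hz⟩ => ⟨r, ⟨h1, h2⟩, hz.symm⟩⟩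

theorem mem_take_reverse_support {k : ℕ} {z : V} :
    z ∈ P.support.reverse.take k ↔ ∃ r ≤ P.length, P.length < r + k ∧ z = P.getVert r := by
  rw [← Walk.support_reverse, mem_take_support]
  simp only [Walk.length_reverse, Walk.getVert_reverse]
  constructor
  · rintro ⟨r, h1, h2, rfl⟩
    exact ⟨_, Nat.sub_le _ _, by omega, rfl⟩
  · rintro ⟨r, h1, h2, rfl⟩
    exact ⟨P.length - r, by omega, Nat.sub_le _ _, by rw [Nat.sub_sub_self h1]⟩

theorem exists_mem_support_iff {p : V → Prop} :
    (∃ z ∈ P.support, p z) ↔ ∃ s ≤ P.length, p (P.getVert s) := by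
  simp only [Walk.mem_support_iff_exists_getVert]
  exact ⟨fun ⟨z, ⟨s, h, hs⟩, hz⟩ => ⟨s, hs, h ▸ hz⟩, fun ⟨s, hs, hz⟩ => ⟨_, ⟨s, rfl, hs⟩, hz⟩⟩

theorem firstNbrIdx_eq {x : V} {s : ℕ} (hs : s ≤ P.length) (hx : G.Adj x (P.getVert s))
    (hmin : ∀ r < s, ¬ G.Adj x (P.getVert r)) : firstNbrIdx G P.support x = s := by
  rw [firstNbrIdx, List.findIdx_eq (by simpa [Nat.lt_succ_iff] using hs)]
  simp only [Walk.support_getElem_eq_getVert, decide_eq_true_eq, decide_eq_false_iff_not]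
  exact ⟨hx, hmin⟩

theorem alpha_eq {x : V} {s : ℕ} (hs : s ≤ P.length) (hx : G.Adj x (P.getVert s))
    (hmin : ∀ r < s, ¬ G.Adj x (P.getVert r)) : alpha G P x = P.getVert s := by
  rw [alpha, firstNbrIdx_eq hs hx hmin, getD_support hs]

theorem beta_eq {x : V} {s : ℕ} (hs : s ≤ P.length) (hx : G.Adj x (P.getVert s))
    (hmax : ∀ r, s < r → r ≤ P.length → ¬ G.Adj x (P.getVert r)) : beta G P x = P.getVert s := by
  have h : beta G P x = alpha G P.reverse x := by
    rw [beta, alpha, Walk.support_reverse]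
  rw [h, alpha_eq (s := P.length - s) (by simp) (by
    rwa [Walk.getVert_reverse, Nat.sub_sub_self hs]) fun r hr => by
      rw [Walk.getVert_reverse]
      exact hmax _ (by omega) (Nat.sub_le _ _), Walk.getVert_reverse, Nat.sub_sub_self hs]

theorem listIdx_getVert (hP : P.IsPath) {s : ℕ} (hs : s ≤ P.length) :
    listIdx P.support (P.getVert s) = s := by
  rw [listIdx, List.findIdx_eq (by simpa [Nat.lt_succ_iff] using hs)]
  simp only [Walk.support_getElem_eq_getVert, decide_eq_true_eq, decide_eq_false_iff_not]
  refine ⟨trivial, fun r hr he => ?_⟩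
  have := hP.getVert_injOn (show r ≤ P.length by omega) hs he
  omega

theorem getVert_mem_Kmn (hP : P.IsPath) {F : Set V} {s r k k' : ℕ} (hs : s ≤ P.length)
    (hr : r ≤ P.length) (hk : s ≤ r + k) (hk' : r ≤ s + k')
    (hF : ∀ q ≤ P.length, min r s < q → q < max r s → P.getVert q ∉ F) :
    P.getVert r ∈ Kmn G F P (P.getVert s) k k' := by
  simp only [Kmn, listIdx_getVert hP hs, Walk.length_support]
  rcases le_total r s with h | h
  · refine .inl ⟨r, h, by omega, fun q h1 h2 => ?_, (getD_support hr _).symm⟩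
    rw [getD_support (by omega)]
    exact hF q (by omega) (by omega) (by omega)
  · refine .inr ⟨r, h, by omega, by omega, fun q h1 h2 => ?_, (getD_support hr _).symm⟩
    rw [getD_support (by omega)]
    exact hF q (by omega) (by omega) (by omega)

theorem mem_Aset {x z : V} :
    z ∈ Aset G P x ↔ ∃ r ≤ P.length, (∀ r' < r, ¬ G.Adj x (P.getVert r')) ∧ z = P.getVert r := by
  classical
  rw [Aset]
  split_ifs with h
  · rw [exists_mem_support_iff] at h
    obtain ⟨h1, h2⟩ := Nat.find_spec h
    have hmin : ∀ r < Nat.find h, ¬ G.Adj x (P.getVert r) := fun r hr ha =>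
      Nat.find_min h hr ⟨by omega, ha⟩
    rw [firstNbrIdx_eq h1 h2 hmin, Set.mem_ofPred_eq, mem_take_support]
    constructor
    · rintro ⟨r, hr, hr', rfl⟩
      exact ⟨r, hr', fun r' h' => hmin r' (by omega), rfl⟩
    · rintro ⟨r, hr, hr', rfl⟩
      exact ⟨r, Nat.lt_succ_of_le (not_lt.1 fun h' => hr' _ h' h2), hr, rfl⟩
  · rw [exists_mem_support_iff] at h
    push Not at h
    rw [vset, Set.mem_ofPred_eq, Walk.mem_support_iff_exists_getVert]
    constructor
    · rintro ⟨r, rfl, hr⟩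
      exact ⟨r, hr, fun r' h' => h r' (by omega), rfl⟩
    · rintro ⟨r, hr, -, rfl⟩
      exact ⟨r, rfl, hr⟩

end Walk

variable {a b : Fin 3 → V} {P : ∀ i, G.Walk (a i) (b i)}

theorem A123_eq {x : V} :
    A123 G P x = UpToFirst G (fun i => (P i).getVert) (fun i => (P i).length) x := by
  ext z
  simp only [A123, Set.mem_iUnion, mem_Aset, UpToFirst, Set.mem_ofPred_eq]

theorem IsLongNearPrism.getVert_mem_frameStar (h : IsLongNearPrism ℓ a b P) {i : Fin 3} {s m : ℕ}
    (hℓ : ℓ = 2 * m + 2) (hs : s ≤ (P i).length) :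
    (P i).getVert s ∈ frameStar ℓ P ↔
      ¬ (m ≤ s ∧ s + m ≤ (P i).length ∧ ℓ ≤ (P i).length) := by
  have key : ∀ j, (P i).getVert s ∈ vset (P j) → j = i := fun j hj => by
    by_contra hne
    exact h.2.2.2.2.1 j i hne _ hj ((P i).getVert_mem_support s)
  have hm : ℓ / 2 - 1 = m := by omega
  have hself : (P i).getVert s ∈ (if (P i).length ≤ ℓ - 1 then vset (P i)
      else {x | x ∈ (P i).support.take (ℓ / 2 - 1)} ∪
        {x | x ∈ (P i).support.reverse.take (ℓ / 2 - 1)}) ↔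
      ¬ (m ≤ s ∧ s + m ≤ (P i).length ∧ ℓ ≤ (P i).length) := by
    split_ifs with hl
    · exact iff_of_true ((P i).getVert_mem_support s) (by omega)
    · rw [Set.mem_union, Set.mem_ofPred_eq, Set.mem_ofPred_eq, mem_take_support,
        mem_take_reverse_support, hm]
      constructor
      · rintro (⟨r, h1, h2, h3⟩ | ⟨r, h1, h2, h3⟩)
        · rw [h.getVert_eq_iff hs h2] at h3
          omega
        · rw [h.getVert_eq_iff hs h1] at h3
          omega
      · intro h'
        by_cases hsm : s < m
        · exact .inl ⟨s, hsm, hs, rfl⟩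
        · exact .inr ⟨s, hs, by omega, rfl⟩
  rw [← hself, frameStar, Set.mem_iUnion]
  refine ⟨fun ⟨j, hj⟩ => ?_, fun h => ⟨i, h⟩⟩
  obtain rfl : j = i := by
    refine key j ?_
    split_ifs at hj
    · exact hj
    · rcases hj with hj | hj
      · exact List.mem_of_mem_take hj
      · exact List.mem_reverse.1 (List.mem_of_mem_take hj)
  exact hj

theorem IsLongNearPrism.mid_of_adj (h : IsLongNearPrism ℓ a b P) (ht : Tidy G ℓ P) {i : Fin 3}
    {s m : ℕ} {x : V} (hℓ : ℓ = 2 * m + 2) (hx : x ∉ prismSupport P) (hs : s ≤ (P i).length)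
    (ha : G.Adj x ((P i).getVert s)) :
    m ≤ s ∧ s + m ≤ (P i).length ∧ ℓ ≤ (P i).length := by
  by_contra hc
  exact (ht.2 ((h.getVert_mem_frameStar hℓ hs).2 hc) hx).2 ha.symm

theorem IsLongNearPrism.getVert_mem_Kmn (h : IsLongNearPrism ℓ a b P) (ht : Tidy G ℓ P) {i : Fin 3}
    {s r m k k' : ℕ} {x y : V} (hℓ : ℓ = 2 * m + 2) (hx : x ∉ prismSupport P)
    (hy : y ∉ prismSupport P) (hs : s ≤ (P i).length) (hxs : G.Adj x ((P i).getVert s))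
    (hr : r ≤ (P i).length) (hyr : G.Adj y ((P i).getVert r)) (hk : s ≤ r + k)
    (hk' : r ≤ s + k') :
    (P i).getVert r ∈ Kmn G (frameStar ℓ P) (P i) ((P i).getVert s) k k' := by
  have h1 := h.mid_of_adj ht hℓ hx hs hxs
  have h2 := h.mid_of_adj ht hℓ hy hr hyr
  refine LEH.getVert_mem_Kmn (h.2.2.2.1 i) hs hr hk hk' fun q hq h3 h4 => ?_
  rw [h.getVert_mem_frameStar hℓ hq, not_not]
  omega

theorem exists_prismGraph_walk {i : Fin 3} {s k : ℕ} (hP : (P i).IsPath)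
    (hs : s + k ≤ (P i).length) :
    ∃ W : (prismGraph G a b P).Walk ((P i).getVert s) ((P i).getVert (s + k)),
      W.IsPath ∧ W.length = k ∧ ∀ r, s ≤ r → r ≤ s + k → (P i).getVert r ∈ W.support := by
  have hle : ∀ e ∈ (((P i).drop s).take k).edges, e ∈ (prismGraph G a b P).edgeSet := by
    intro e he
    have he' : e ∈ (P i).edges :=
      ((P i).isSubwalk_drop s).edges_subset ((((P i).drop s).isSubwalk_take k).edges_subset he)
    rw [prismGraph, edgeSet_fromEdgeSet]
    exact ⟨.inr ⟨i, he'⟩, fun hd => G.not_isDiag_of_mem_edgeSet ((P i).edges_subset_edgeSet he') hd⟩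
  refine ⟨((((P i).drop s).take k).transfer _ hle).copy rfl (by rw [Walk.drop_getVert]), ?_, ?_, ?_⟩
  · rw [Walk.isPath_copy]
    exact ((hP.drop s).take k).transfer hle
  · simp
    omega
  · intro r h1 h2
    rw [Walk.support_copy, Walk.support_transfer, Walk.mem_support_iff_exists_getVert]
    refine ⟨r - s, ?_, ?_⟩
    · rw [Walk.take_getVert, Walk.drop_getVert]
      congr 1
      omega
    · simp
      omega

theorem IsLongNearPrism.spread (h : IsLongNearPrism ℓ a b P) (ht : Tidy G ℓ P) {m : ℕ} {x : V}
    (hℓ : ℓ = 2 * m + 2) (hx : KMajor G P x) :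
    Spread G ℓ m (fun i => (P i).getVert) (fun i => (P i).length) x := by
  refine ⟨fun i s _ he => hx.1 ?_, fun i s hs ha => h.mid_of_adj ht hℓ hx.1 hs ha,
    fun i hi => ?_⟩
  · rw [he]
    exact Set.mem_iUnion.2 ⟨i, (P i).getVert_mem_support s⟩
  · by_contra! hc
    refine hx.2 ?_
    have hmem : ∀ z ∈ prismSupport P, G.Adj x z →
        ∃ r ≤ (P i).length, G.Adj x ((P i).getVert r) ∧ z = (P i).getVert r := by
      intro z hz hxz
      obtain ⟨j, hj⟩ := Set.mem_iUnion.1 hz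
      obtain ⟨r, rfl, hr⟩ := Walk.mem_support_iff_exists_getVert.1 hj
      rcases eq_or_ne i j with rfl | hij
      · exact ⟨r, hr, hxz, rfl⟩
      · exact (hi j hij r hr hxz).elim
    by_cases hn : ∃ s, s ≤ (P i).length ∧ G.Adj x ((P i).getVert s)
    · obtain ⟨s, ⟨hs, hxs⟩, hmin⟩ : ∃ s, (s ≤ (P i).length ∧ G.Adj x ((P i).getVert s)) ∧
          ∀ r ≤ (P i).length, G.Adj x ((P i).getVert r) → s ≤ r := by
        classical
        exact ⟨Nat.find hn, Nat.find_spec hn, fun r hr hxr => Nat.find_min' hn ⟨hr, hxr⟩⟩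
      obtain ⟨W, hW, hWl, hWs⟩ := exists_prismGraph_walk (a := a) (b := b) (P := P)
        (k := min 2 ((P i).length - s)) (h.2.2.2.1 i) (by omega : s + _ ≤ _)
      refine ⟨_, _, W, hW, by omega, fun z hz hxz => ?_⟩
      obtain ⟨r, hr, hxr, rfl⟩ := hmem z hz hxz
      have := hmin r hr hxr
      refine hWs r this (not_lt.1 fun hlt => ?_)
      exact hc s r (by omega) hr hxs hxr
    · refine ⟨a i, a i, .nil, .nil, by simp, fun z hz hxz => ?_⟩
      obtain ⟨r, hr, hxr, -⟩ := hmem z hz hxz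
      exact (hn ⟨r, hr, hxr⟩).elim

theorem IsLongNearPrism.apart (h : IsLongNearPrism ℓ a b P) (ht : Tidy G ℓ P) {m : ℕ} {x y : V}
    (hℓ : ℓ = 2 * m + 2) (hx : x ∉ prismSupport P) (hy : y ∉ prismSupport P)
    (hd : Distant G ℓ P x y) :
    Apart G m (fun i => (P i).getVert) (fun i => (P i).length) x y := by
  refine ⟨hd.1, fun i s hs hxs hmin r hr h1 h2 hyr => ?_, fun i hi => ?_⟩
  · refine hd.2.2.1 i (exists_mem_support_iff.2 ⟨s, hs, hxs⟩) _ ?_ hyr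
    rw [alpha_eq hs hxs hmin]
    exact h.getVert_mem_Kmn ht hℓ hx hy hs hxs hr hyr (by omega) h2
  · obtain ⟨j, hji, hj⟩ := hd.2.2.2 i fun he => by
      obtain ⟨s, hs, hxs⟩ := exists_mem_support_iff.1 he
      exact hi s hs hxs
    refine ⟨j, hji.symm, fun s hs hxs hmax r hr h1 h2 hyr => hj _ ?_ hyr⟩
    rw [beta_eq hs hxs hmax]
    exact h.getVert_mem_Kmn ht hℓ hx hy hs hxs hr hyr (by omega) (by omega)

end LEH

/-- if `y` is distant from `x`, then `y` has exactly two neighbours in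
`A₁₂₃(x)` and they are adjacent. -/
theorem distant_two_adjacent_nbrs {V : Type*} [Fintype V]
    (ℓ : ℕ) (hℓ : 6 ≤ ℓ) (hℓeven : Even ℓ)
    (G : SimpleGraph V) (hnt : ¬ HasLongTheta G ℓ)
    {a b : Fin 3 → V} (P : ∀ i : Fin 3, G.Walk (a i) (b i))
    (hsh : ShortestLNP G ℓ P) (htidy : Tidy G ℓ P)
    (x y : V) (hx : KMajor G P x) (hy : KMajor G P y)
    (hd : Distant G ℓ P x y) :
    ∃ z₁ z₂, z₁ ∈ A123 G P x ∧ z₂ ∈ A123 G P x ∧ z₁ ≠ z₂ ∧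
      G.Adj y z₁ ∧ G.Adj y z₂ ∧ G.Adj z₁ z₂ ∧
      ∀ z ∈ A123 G P x, G.Adj y z → z = z₁ ∨ z = z₂ := by
  obtain ⟨k, hk⟩ := hℓeven
  have hm : ℓ = 2 * (k - 1) + 2 := by omega
  have hlong : ∀ i j, i ≠ j → ℓ ≤ (P i).length ∨ ℓ ≤ (P j).length := fun i j hij => by
    by_contra! hc
    exact hij (htidy.1 i j (by omega) (by omega))
  rw [A123_eq]
  refine (hsh.1.indexedPrism hlong).exists_edge (hsh.1.spread htidy hm hx)
    (hsh.1.spread htidy hm hy) (hsh.1.apart htidy hm hx.1 hy.1 hd) hm (by omega) hnt ?_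
    (A123_eq ▸ hd.2.1)
  rintro N ⟨a', b', P', h', hN⟩
  exact hsh.1.ncard_prismSupport ▸ (hsh.2 a' b' P' h').trans hN
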